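/- arXiv:2208.10055 — 2 statements merged into one kernel-verified Lean document; each statement's English description precedes it below -/
import Mathlib

section
/- In the arc-and-ball setting below, for every i ∈ ℕ, every x_0^R ∈ E_0^R and every x_*^R ∈ E^R_{[0,1]} lying in the connected component of E^R_{[0,1]} containing x_0^R, there is a bijection (an isomorphism of relative homotopy groups) π_i(E^-_{[0,1]}, E_0^R, x_0^R) ≅ π_i(E^-_{[0,1]}, E^R_{[0,1]}, x_*^R), induced by the inclusion E_0^R ⊆ E^R_{[0,1]}. -/
open scoped unitInterval
open Set Filter Topology Metric

noncomputable section

/-! ### Cubes and relative homotopy groups -/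

/-- The `n`-dimensional unit cube `I^n = [0,1]^n`. -/
abbrev Cube (n : ℕ) := Fin n → I

/-- The subset `J_{i+1} = ∂ I^{i+1} ∖ (Int I^i × {0})` of the cube `I^{i+1}`;
the last coordinate plays the role of the distinguished (base-face) coordinate. -/
def JSet (i : ℕ) : Set (Cube (i + 1)) :=
  {p | (∃ j, p j = 0 ∨ p j = 1) ∧
    ¬(p (Fin.last i) = 0 ∧ ∀ j : Fin i, p j.castSucc ≠ 0 ∧ p j.castSucc ≠ 1)}

/-- A continuous map `h : I^{i+1} → A` with `h(I^i × {0}) ⊆ B` and `h(J_{i+1}) = {x0}`,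
i.e. the maps representing elements of the relative homotopy group `π_{i+1}(A, B, x0)`. -/
structure IsRelMap {X : Type*} [TopologicalSpace X] (i : ℕ) (A B : Set X) (x0 : X)
    (h : Cube (i + 1) → X) : Prop where
  continuous : Continuous h
  mem_total : ∀ p, h p ∈ A
  mem_base : ∀ p : Cube (i + 1), p (Fin.last i) = 0 → h p ∈ B
  eq_base_pt : ∀ p ∈ JSet i, h p = x0

/-- Homotopy of two representing maps through maps of the same form. -/
def RelHomotopic {X : Type*} [TopologicalSpace X] (i : ℕ) (A B : Set X) (x0 : X)
    (h₀ h₁ : Cube (i + 1) → X) : Prop :=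
  ∃ H : Cube (i + 1) × I → X, Continuous H ∧
    (∀ τ : I, IsRelMap i A B x0 fun p => H (p, τ)) ∧
    (∀ p, H (p, 0) = h₀ p) ∧ ∀ p, H (p, 1) = h₁ p

/-- `π_{i+1}(A, B, x0) = 1`: every representing map is homotopic, through maps of the same
form, to a map with image contained in `B`. -/
def RelPiTrivial {X : Type*} [TopologicalSpace X] (i : ℕ) (A B : Set X) (x0 : X) : Prop :=
  ∀ h : Cube (i + 1) → X, IsRelMap i A B x0 h →
    ∃ h' : Cube (i + 1) → X, IsRelMap i A B x0 h' ∧ (∀ p, h' p ∈ B) ∧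
      RelHomotopic i A B x0 h h'

/-- The set of homotopy classes forming the relative homotopy group `π_{i+1}(A, B, x0)`. -/
def RelPi {X : Type*} [TopologicalSpace X] (i : ℕ) (A B : Set X) (x0 : X) : Type _ :=
  Quot fun h₁ h₂ : {h : Cube (i + 1) → X // IsRelMap i A B x0 h} =>
    RelHomotopic i A B x0 h₁.1 h₂.1

theorem IsRelMap.mono {X : Type*} [TopologicalSpace X] {i : ℕ} {A A' B B' : Set X} {x0 : X}
    {h : Cube (i + 1) → X} (hh : IsRelMap i A B x0 h) (hA : A ⊆ A') (hB : B ⊆ B') :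
    IsRelMap i A' B' x0 h :=
  ⟨hh.continuous, fun p => hA (hh.mem_total p), fun p hp => hB (hh.mem_base p hp),
    hh.eq_base_pt⟩

theorem RelHomotopic.mono {X : Type*} [TopologicalSpace X] {i : ℕ} {A A' B B' : Set X}
    {x0 : X} {h₀ h₁ : Cube (i + 1) → X} (hr : RelHomotopic i A B x0 h₀ h₁)
    (hA : A ⊆ A') (hB : B ⊆ B') : RelHomotopic i A' B' x0 h₀ h₁ := by
  obtain ⟨H, hc, hsl, h0, h1⟩ := hr
  exact ⟨H, hc, fun τ => (hsl τ).mono hA hB, h0, h1⟩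

/-- The map of relative homotopy groups induced by an inclusion of pairs `(A,B) ⊆ (A',B')`. -/
def RelPi.incl {X : Type*} [TopologicalSpace X] {i : ℕ} {A A' B B' : Set X} {x0 : X}
    (hA : A ⊆ A') (hB : B ⊆ B') : RelPi i A B x0 → RelPi i A' B' x0 :=
  Quot.map (fun h => ⟨h.1, h.2.mono hA hB⟩) fun _ _ hr => hr.mono hA hB

/-! ### Serre fibrations, locally trivial fibrations, s-arcs -/

/-- A continuous surjection `p : E → B` is a Serre fibration if it has the homotopy lifting
property with respect to all finite-dimensional cubes. -/
def IsSerreFibration {E B : Type*} [TopologicalSpace E] [TopologicalSpace B]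
    (p : E → B) : Prop :=
  Continuous p ∧ Function.Surjective p ∧
    ∀ (k : ℕ) (H : Cube k × I → B) (h : Cube k → E),
      Continuous H → Continuous h → (∀ q, p (h q) = H (q, 0)) →
      ∃ G : Cube k × I → E, Continuous G ∧ (∀ q, p (G q) = H q) ∧ ∀ q, G (q, 0) = h q

/-- `f` is a locally trivial fibration over `S`: every `t ∈ S` has a neighborhood `V ∩ S`
in `S` such that `f ⁻¹' (V ∩ S)` is homeomorphic to `(V ∩ S) × f ⁻¹' {t}` over `f`. -/
def IsLocTrivOn {E B : Type*} [TopologicalSpace E] [TopologicalSpace B]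
    (f : E → B) (S : Set B) : Prop :=
  ∀ t ∈ S, ∃ V : Set B, IsOpen V ∧ t ∈ V ∧
    ∃ φ : ↥(f ⁻¹' (V ∩ S)) ≃ₜ ↥(V ∩ S) × ↥(f ⁻¹' {t}), ∀ x, ((φ x).1 : B) = f (x : E)

/-- `δ` is an s-arc on `S` at `t0`: the image of an embedding `γ : [0,1] → B` with
`γ 0 = t0` and `γ((0,1]) ⊆ S`. -/
def IsSArc {B : Type*} [TopologicalSpace B] (S : Set B) (t0 : B) (δ : Set B) : Prop :=
  ∃ γ : I → B, Continuous γ ∧ Function.Injective γ ∧ γ 0 = t0 ∧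
    (∀ s : I, s ≠ 0 → γ s ∈ S) ∧ δ = Set.range γ

/-- `f` has no vanishing component at `t0`: for every embedded arc `γ` starting at `t0`
over whose image minus `t0` the map `f` is a locally trivial fibration, every connected
component of `f ⁻¹' (γ((0,1]))` has closure meeting the fiber `f ⁻¹' {t0}`. -/
def NoVanishingComponent {E B : Type*} [TopologicalSpace E] [TopologicalSpace B]
    (f : E → B) (t0 : B) : Prop :=
  ∀ γ : I → B, Continuous γ → Function.Injective γ → γ 0 = t0 →
    IsLocTrivOn f (γ '' {s : I | s ≠ 0}) →
    ∀ x ∈ f ⁻¹' (γ '' {s : I | s ≠ 0}),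
      (closure (connectedComponentIn (f ⁻¹' (γ '' {s : I | s ≠ 0})) x) ∩
        f ⁻¹' {t0}).Nonempty

/-! ### Polynomial maps and semialgebraic sets -/

/-- A polynomial map `ℝ^m → ℝ^n`: each component is (the evaluation of) a real
polynomial in `m` variables. -/
def IsPolyMap {m n : ℕ} (f : EuclideanSpace ℝ (Fin m) → EuclideanSpace ℝ (Fin n)) : Prop :=
  ∀ j : Fin n, ∃ P : MvPolynomial (Fin m) ℝ, ∀ x, f x j = MvPolynomial.eval (fun k => x k) P

/-- Semialgebraic subsets of `ℝ^n`. -/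
inductive IsSemialgebraic {n : ℕ} : Set (EuclideanSpace ℝ (Fin n)) → Prop
  | zeroSet (P : MvPolynomial (Fin n) ℝ) :
      IsSemialgebraic {x | MvPolynomial.eval (fun j => x j) P = 0}
  | posSet (P : MvPolynomial (Fin n) ℝ) :
      IsSemialgebraic {x | 0 < MvPolynomial.eval (fun j => x j) P}
  | union {s t : Set (EuclideanSpace ℝ (Fin n))} :
      IsSemialgebraic s → IsSemialgebraic t → IsSemialgebraic (s ∪ t)
  | inter {s t : Set (EuclideanSpace ℝ (Fin n))} :
      IsSemialgebraic s → IsSemialgebraic t → IsSemialgebraic (s ∩ t)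
  | compl {s : Set (EuclideanSpace ℝ (Fin n))} :
      IsSemialgebraic s → IsSemialgebraic sᶜ

/-! ### Spheres, vanishing and emerging cycles -/

/-- The `i`-dimensional sphere, realized as the unit sphere in `ℝ^{i+1}`. -/
def SphS (i : ℕ) : Set (EuclideanSpace ℝ (Fin (i + 1))) := Metric.sphere 0 1

/-- The base point of the `i`-dimensional sphere. -/
def spherePt (i : ℕ) : ↥(SphS i) := ⟨EuclideanSpace.single 0 1, by simp [SphS]⟩

/-- A map `h : Z → E` is null-homotopic in `A ⊆ E` (its image being contained in `A`)
if it is homotopic within `A` to a constant map. -/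
def NullHomotopicIn {Z E : Type*} [TopologicalSpace Z] [TopologicalSpace E]
    (h : Z → E) (A : Set E) : Prop :=
  ∃ (H : Z × I → E) (c : E), Continuous H ∧ (∀ q, H q ∈ A) ∧
    (∀ z, H (z, 0) = h z) ∧ ∀ z, H (z, 1) = c

/-- Two maps `h₀ h₁ : Z → E` are (freely) homotopic in `A ⊆ E`. -/
def HomotopicIn {Z E : Type*} [TopologicalSpace Z] [TopologicalSpace E]
    (h₀ h₁ : Z → E) (A : Set E) : Prop :=
  ∃ H : Z × I → E, Continuous H ∧ (∀ q, H q ∈ A) ∧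
    (∀ z, H (z, 0) = h₀ z) ∧ ∀ z, H (z, 1) = h₁ z

/-- Two maps `h₀ h₁ : Z → E` are homotopic in `A ⊆ E` relative to the base point `z0`. -/
def HomotopicInRel {Z E : Type*} [TopologicalSpace Z] [TopologicalSpace E]
    (h₀ h₁ : Z → E) (A : Set E) (z0 : Z) : Prop :=
  ∃ H : Z × I → E, Continuous H ∧ (∀ q, H q ∈ A) ∧
    (∀ z, H (z, 0) = h₀ z) ∧ (∀ z, H (z, 1) = h₁ z) ∧ ∀ τ, H (z0, τ) = h₀ z0

/-- A vanishing `i`-cycle of `f` over the parametrized arc `γ`: a fibered map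
`g : S^i × [0,1] → E` over `γ` such that `g(·,s)` is null-homotopic in the fiber
`f ⁻¹' {γ s}` for every `s > 0`. -/
def IsVanishingCycle {E B : Type*} [TopologicalSpace E] [TopologicalSpace B]
    (f : E → B) (γ : I → B) (i : ℕ) (g : ↥(SphS i) × I → E) : Prop :=
  Continuous g ∧ (∀ x s, f (g (x, s)) = γ s) ∧
    ∀ s : I, s ≠ 0 → NullHomotopicIn (fun x => g (x, s)) (f ⁻¹' {γ s})

/-- A vanishing cycle is trivial if `g(·,0)` is also null-homotopic in `f ⁻¹' {γ 0}`. -/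
def VanishingCycleTrivial {E B : Type*} [TopologicalSpace E] [TopologicalSpace B]
    (f : E → B) (γ : I → B) (i : ℕ) (g : ↥(SphS i) × I → E) : Prop :=
  NullHomotopicIn (fun x => g (x, 0)) (f ⁻¹' {γ 0})

/-- An emerging `i`-cycle of `f` over the parametrized arc `γ`: a fibered map
`g : S^i × (0,1] → E` over `γ` such that the base point image `g(x₀,s)` has a limit
as `s → 0`. -/
def IsEmergingCycle {E B : Type*} [TopologicalSpace E] [TopologicalSpace B]
    (f : E → B) (γ : I → B) (i : ℕ) (g : ↥(SphS i) × {s : I // s ≠ 0} → E) : Prop :=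
  Continuous g ∧ (∀ x s, f (g (x, s)) = γ s.1) ∧
    ∃ L : E, Filter.Tendsto (fun s : {s : I // s ≠ 0} => g (spherePt i, s))
      (Filter.comap Subtype.val (𝓝[≠] (0 : I))) (𝓝 L)

/-- An emerging cycle is trivial if it agrees near `0`, up to fiberwise base-point
preserving homotopy, with a fibered map defined on `S^i × [0,ε)`. -/
def EmergingCycleTrivial {E B : Type*} [TopologicalSpace E] [TopologicalSpace B]
    (f : E → B) (γ : I → B) (i : ℕ) (g : ↥(SphS i) × {s : I // s ≠ 0} → E) : Prop :=
  ∃ ε : I, ε ≠ 0 ∧ ∃ g' : ↥(SphS i) × {s : I // (s : ℝ) < (ε : ℝ)} → E,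
    Continuous g' ∧ (∀ x s, f (g' (x, s)) = γ s.1) ∧
      ∀ (s : {s : I // s ≠ 0}) (hs : ((s : I) : ℝ) < (ε : ℝ)),
        g' (spherePt i, ⟨s.1, hs⟩) = g (spherePt i, s) ∧
        HomotopicInRel (fun x => g (x, s)) (fun x => g' (x, ⟨s.1, hs⟩))
          (f ⁻¹' {γ s.1}) (spherePt i)

/-! ### Relative homotopy classes: pushing along a deformation of the base pair -/

theorem mem_JSet_iff {i : ℕ} {p : Cube (i + 1)} :
    p ∈ JSet i ↔ (∃ j : Fin i, p j.castSucc = 0 ∨ p j.castSucc = 1) ∨ p (Fin.last i) = 1 := by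
  constructor
  · rintro ⟨⟨j, hj⟩, h2⟩
    induction j using Fin.lastCases with
    | last =>
      rcases hj with hj | hj
      · left
        by_contra hcon
        push Not at hcon
        exact h2 ⟨hj, hcon⟩
      · exact Or.inr hj
    | cast j => exact Or.inl ⟨j, hj⟩
  · rintro (⟨j, hj⟩ | h)
    · refine ⟨⟨_, hj⟩, fun h2 => ?_⟩
      rcases hj with hj | hj
      · exact (h2.2 j).1 hj
      · exact (h2.2 j).2 hj
    · refine ⟨⟨_, Or.inr h⟩, fun h2 => ?_⟩
      rw [h] at h2
      exact one_ne_zero h2.1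

/-- The height at which the rescaled map is evaluated above the collar of width `τ / 2`. -/
def collarHeight (t τ : I) : I :=
  projIcc 0 1 zero_le_one (((t : ℝ) - τ / 2) / (1 - τ / 2))

/-- The deformation time used inside the collar of width `τ / 2`. -/
def collarTime (t τ : I) : I := projIcc 0 1 zero_le_one ((τ : ℝ) - 2 * t)

theorem Continuous.collarHeight {Z : Type*} [TopologicalSpace Z] {f g : Z → I}
    (hf : Continuous f) (hg : Continuous g) : Continuous fun z => collarHeight (f z) (g z) := by
  refine continuous_projIcc.comp (Continuous.div (by fun_prop) (by fun_prop) fun z => ?_)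
  have := (g z).2.2
  linarith

theorem Continuous.collarTime {Z : Type*} [TopologicalSpace Z] {f g : Z → I}
    (hf : Continuous f) (hg : Continuous g) : Continuous fun z => collarTime (f z) (g z) :=
  continuous_projIcc.comp (by fun_prop)

theorem collarHeight_one (τ : I) : collarHeight 1 τ = 1 := by
  have := τ.2.2
  have h : ((1 : ℝ) - τ / 2) ≠ 0 := by linarith
  simp [collarHeight, div_self h]

theorem collarHeight_eq_zero {t τ : I} (h : (2 : ℝ) * t ≤ τ) : collarHeight t τ = 0 := by
  have := τ.2.2
  refine projIcc_of_le_left _ (div_nonpos_of_nonpos_of_nonneg ?_ ?_) <;> linarith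

theorem collarHeight_zero_right (t : I) : collarHeight t 0 = t := by
  simp [collarHeight]

theorem collarTime_eq_zero {t τ : I} (h : (τ : ℝ) ≤ 2 * t) : collarTime t τ = 0 :=
  projIcc_of_le_left _ (by linarith)

theorem collarTime_zero_left (τ : I) : collarTime 0 τ = τ := by
  simp [collarTime]

/-- Push the base face of a cube map along the deformation `D` during time `τ`, using the
collar `{2 t ≤ τ}` of the base face. -/
def pushBase {X : Type*} {i : ℕ} (D : X × I → X) (τ : I) (h : Cube (i + 1) → X)
    (p : Cube (i + 1)) : X :=
  if (τ : ℝ) ≤ 2 * p (Fin.last i) then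
    h (Function.update p (Fin.last i) (collarHeight (p (Fin.last i)) τ))
  else
    D (h (Function.update p (Fin.last i) (collarHeight (p (Fin.last i)) τ)),
      collarTime (p (Fin.last i)) τ)

theorem pushBase_zero {X : Type*} {i : ℕ} {D : X × I → X} (h : Cube (i + 1) → X) (p : Cube (i + 1)) :
    pushBase D 0 h p = h p := by
  have : (0 : ℝ) ≤ 2 * (p (Fin.last i) : ℝ) := by have := (p (Fin.last i)).2.1; linarith
  simp [pushBase, this, collarHeight_zero_right]

section pushBase

variable {X : Type*} [TopologicalSpace X] {i : ℕ} {A B B' : Set X} {x0 : X} {D : X × I → X}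

theorem continuous_pushBase {Z : Type*} [TopologicalSpace Z]
    (hD : ContinuousOn D (B' ×ˢ univ)) (hD0 : ∀ x ∈ B', D (x, 0) = x)
    {H : Cube (i + 1) × Z → X} (hH : Continuous H)
    (hHB : ∀ p z, p (Fin.last i) = 0 → H (p, z) ∈ B') {τ : Z → I} (hτ : Continuous τ) :
    Continuous fun q : Cube (i + 1) × Z => pushBase D (τ q.2) (fun p => H (p, q.2)) q.1 := by
  have hlast : Continuous fun q : Cube (i + 1) × Z => q.1 (Fin.last i) := by fun_prop
  have hti : Continuous fun q : Cube (i + 1) × Z =>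
      collarTime (q.1 (Fin.last i)) (τ q.2) := hlast.collarTime (hτ.comp continuous_snd)
  have hin : Continuous fun q : Cube (i + 1) × Z =>
      H (Function.update q.1 (Fin.last i) (collarHeight (q.1 (Fin.last i)) (τ q.2)), q.2) :=
    hH.comp ((continuous_fst.update _ (hlast.collarHeight (hτ.comp continuous_snd))).prodMk
      continuous_snd)
  have hmem : ∀ q : Cube (i + 1) × Z, (2 : ℝ) * q.1 (Fin.last i) ≤ τ q.2 →
      H (Function.update q.1 (Fin.last i) (collarHeight (q.1 (Fin.last i)) (τ q.2)), q.2)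
        ∈ B' := fun q hq => hHB _ _ (by simp [collarHeight_eq_zero hq])
  refine continuous_if_le (by fun_prop) (by fun_prop) hin.continuousOn ?_ ?_
  · exact hD.comp (hin.prodMk hti).continuousOn fun q hq => ⟨hmem q hq, mem_univ _⟩
  · intro q hq
    rw [collarTime_eq_zero hq.le, hD0 _ (hmem q hq.ge)]

theorem IsRelMap.pushBase (hD : ContinuousOn D (B' ×ˢ univ)) (hD0 : ∀ x ∈ B', D (x, 0) = x)
    (hDB' : ∀ x ∈ B', ∀ t, D (x, t) ∈ B') (hx0 : ∀ t, D (x0, t) = x0) (hA : B' ⊆ A)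
    {h : Cube (i + 1) → X} (hh : IsRelMap i A B' x0 h) (τ : I) {C : Set X}
    (hC : ∀ x ∈ h '' {p | p (Fin.last i) = 0}, D (x, τ) ∈ C) :
    IsRelMap i A C x0 (pushBase D τ h) where
  continuous := by
    have := continuous_pushBase (Z := Unit) hD hD0 (H := fun q => h q.1)
      (hh.continuous.comp continuous_fst) (fun p _ hp => hh.mem_base p hp)
      (τ := fun _ => τ) continuous_const
    exact this.comp (Continuous.prodMk continuous_id (continuous_const (y := ())))
  mem_total p := by
    unfold _root_.pushBase
    split_ifs with hp
    · exact hh.mem_total _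
    · refine hA (hDB' _ (hh.mem_base _ ?_) _)
      simp [collarHeight_eq_zero (not_le.1 hp).le]
  mem_base p hp := by
    have hmem : h p ∈ h '' {p | p (Fin.last i) = 0} := ⟨p, hp, rfl⟩
    have hupd : Function.update p (Fin.last i) 0 = p := by rw [← hp, Function.update_eq_self]
    have hh0 : collarHeight 0 τ = 0 := collarHeight_eq_zero (by simpa using τ.2.1)
    unfold _root_.pushBase
    rw [hp, hh0, hupd, collarTime_zero_left]
    split_ifs with hτ
    · have : τ = 0 := le_antisymm (Subtype.coe_le_coe.1 (by simpa using hτ)) τ.2.1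
      have h2 := hC _ hmem
      rwa [this, hD0 _ (hh.mem_base p hp)] at h2
    · exact hC _ hmem
  eq_base_pt p hp := by
    have hbd : h (Function.update p (Fin.last i) (collarHeight (p (Fin.last i)) τ)) = x0 := by
      refine hh.eq_base_pt _ (mem_JSet_iff.2 ?_)
      rcases mem_JSet_iff.1 hp with ⟨j, hj⟩ | hp
      · left
        refine ⟨j, ?_⟩
        rwa [Function.update_of_ne (Fin.castSucc_lt_last j).ne]
      · right
        simp [hp, collarHeight_one]
    unfold _root_.pushBase
    split_ifs
    · exact hbd
    · rw [hbd, hx0]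

theorem RelPi.incl_bijective_of_deformation (hD : ContinuousOn D (B' ×ˢ univ))
    (hD0 : ∀ x ∈ B', D (x, 0) = x) (hDB' : ∀ x ∈ B', ∀ t, D (x, t) ∈ B')
    (hDB : ∀ x ∈ B, ∀ t, D (x, t) = x) (hD1 : ∀ x ∈ B', D (x, 1) ∈ B) (hx0 : x0 ∈ B)
    (hA : B' ⊆ A) (hAA : A ⊆ A) (hB : B ⊆ B') :
    Function.Bijective (RelPi.incl (i := i) (x0 := x0) hAA hB) := by
  have hfix : ∀ t, D (x0, t) = x0 := hDB x0 hx0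
  have key : ∀ h, IsRelMap i A B' x0 h → IsRelMap i A B x0 (pushBase D 1 h) := fun h hh =>
    hh.pushBase hD hD0 hDB' hfix hA 1 (by
      rintro _ ⟨p, hp, rfl⟩
      exact hD1 _ (hh.mem_base p hp))
  let K : RelPi i A B' x0 → RelPi i A B x0 :=
    Quot.map (fun h => ⟨pushBase D 1 h.1, key h.1 h.2⟩) (by
      rintro ⟨h₀, hh₀⟩ ⟨h₁, hh₁⟩ ⟨H, hc, hsl, h0, h1⟩
      refine ⟨fun q => pushBase D 1 (fun p => H (p, q.2)) q.1, ?_, ?_, ?_, ?_⟩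
      · exact continuous_pushBase hD hD0 hc (fun p z hp => (hsl z).mem_base p hp)
          continuous_const
      · exact fun τ => key _ (hsl τ)
      · intro p
        simp only [h0]
      · intro p
        simp only [h1])
  have push : ∀ (C : Set X), C ⊆ B' → (∀ x ∈ C, ∀ t, D (x, t) ∈ C) →
      ∀ h, IsRelMap i A C x0 h → RelHomotopic i A C x0 h (pushBase D 1 h) := by
    intro C hCB hC h hh
    refine ⟨fun q => pushBase D q.2 h q.1, ?_, ?_, ?_, ?_⟩
    · exact continuous_pushBase hD hD0 (H := fun q => h q.1)
        (hh.continuous.comp continuous_fst) (fun p _ hp => hCB (hh.mem_base p hp))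
        continuous_id
    · intro τ
      refine (hh.mono subset_rfl hCB).pushBase hD hD0 hDB' hfix hA τ ?_
      rintro _ ⟨p, hp, rfl⟩
      exact hC _ (hh.mem_base p hp) _
    · exact fun p => pushBase_zero h p
    · exact fun p => rfl
  refine Function.bijective_iff_has_inverse.2 ⟨K, ?_, ?_⟩
  · rintro ⟨h, hh⟩
    exact (Quot.sound (r := fun h₁ h₂ : {h : Cube (i + 1) → X // IsRelMap i A B x0 h} =>
      RelHomotopic i A B x0 h₁.1 h₂.1) (a := ⟨h, hh⟩) (b := ⟨_, key h (hh.mono subset_rfl hB)⟩)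
      (push B hB (fun x hx t => by rwa [hDB x hx t]) h hh)).symm
  · rintro ⟨h, hh⟩
    exact (Quot.sound (r := fun h₁ h₂ : {h : Cube (i + 1) → X // IsRelMap i A B' x0 h} =>
      RelHomotopic i A B' x0 h₁.1 h₂.1) (a := ⟨h, hh⟩) (b := ⟨_, (key h hh).mono subset_rfl hB⟩)
      (push B' subset_rfl hDB' h hh)).symm

end pushBase

/-! ### Change of base point along a path in the base pair -/

/-- Squeeze a cube towards the complement of `JSet`; the parameter interpolates between the
identity (`θ = 0`) and the map collapsing the outer half of the cube to `JSet` (`θ = 1`). -/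
def squeezeCube {i : ℕ} (θ : I) (p : Cube (i + 1)) : Cube (i + 1) :=
  Fin.lastCases (projIcc 0 1 zero_le_one ((1 + (θ : ℝ)) * p (Fin.last i)))
    fun j => projIcc 0 1 zero_le_one ((1 + (θ : ℝ)) * p j.castSucc - θ / 2)

@[simp] theorem squeezeCube_last {i : ℕ} (θ : I) (p : Cube (i + 1)) :
    squeezeCube θ p (Fin.last i) =
      projIcc 0 1 zero_le_one ((1 + (θ : ℝ)) * p (Fin.last i)) := by
  simp [squeezeCube]

@[simp] theorem squeezeCube_castSucc {i : ℕ} (θ : I) (p : Cube (i + 1)) (j : Fin i) :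
    squeezeCube θ p j.castSucc =
      projIcc 0 1 zero_le_one ((1 + (θ : ℝ)) * p j.castSucc - θ / 2) := by
  simp [squeezeCube]

theorem continuous_squeezeCube {i : ℕ} :
    Continuous fun q : Cube (i + 1) × I => squeezeCube q.2 q.1 := by
  refine continuous_pi fun k => ?_
  induction k using Fin.lastCases with
  | last =>
    simp only [squeezeCube_last]
    exact continuous_projIcc.comp (f := fun q : Cube (i + 1) × I =>
      (1 + (q.2 : ℝ)) * q.1 (Fin.last i)) (by fun_prop)
  | cast j =>
    simp only [squeezeCube_castSucc]
    exact continuous_projIcc.comp (f := fun q : Cube (i + 1) × I =>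
      (1 + (q.2 : ℝ)) * q.1 j.castSucc - q.2 / 2) (by fun_prop)

theorem squeezeCube_zero {i : ℕ} (p : Cube (i + 1)) : squeezeCube 0 p = p := by
  ext k
  induction k using Fin.lastCases <;> simp

theorem squeezeCube_mem_JSet {i : ℕ} (θ : I) {p : Cube (i + 1)} (hp : p ∈ JSet i) :
    squeezeCube θ p ∈ JSet i := by
  have := θ.2.1
  rw [mem_JSet_iff] at hp ⊢
  rcases hp with ⟨j, hj | hj⟩ | hp
  · exact Or.inl ⟨j, Or.inl (by rw [squeezeCube_castSucc, hj]; exact projIcc_of_le_left _ (by simp; linarith))⟩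
  · exact Or.inl ⟨j, Or.inr (by rw [squeezeCube_castSucc, hj]; exact projIcc_of_right_le _ (by simp; linarith))⟩
  · exact Or.inr (by rw [squeezeCube_last, hp]; exact projIcc_of_right_le _ (by simp; linarith))

/-- A function on the cube which is at least `1` on `JSet` and whose nonnegativity set is
collapsed to `JSet` by `squeezeCube 1`. -/
def outerLevel {i : ℕ} (p : Cube (i + 1)) : ℝ :=
  max (4 * ‖fun j : Fin i => (p j.castSucc : ℝ) - 1 / 2‖ - 1) (2 * p (Fin.last i) - 1)

theorem continuous_outerLevel {i : ℕ} : Continuous (outerLevel (i := i)) := by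
  unfold outerLevel
  fun_prop

theorem one_le_outerLevel {i : ℕ} {p : Cube (i + 1)} (hp : p ∈ JSet i) : 1 ≤ outerLevel p := by
  rcases mem_JSet_iff.1 hp with ⟨j, hj⟩ | hp
  · refine le_max_of_le_left ?_
    have h := norm_le_pi_norm (fun j : Fin i => (p j.castSucc : ℝ) - 1 / 2) j
    have h2 : ‖(p j.castSucc : ℝ) - 1 / 2‖ = 1 / 2 := by
      rcases hj with hj | hj <;> rw [hj] <;> norm_num
    rw [h2] at h
    linarith
  · refine le_max_of_le_right ?_
    rw [hp]
    norm_num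

theorem squeezeCube_one_mem_JSet {i : ℕ} {p : Cube (i + 1)} (hp : 0 ≤ outerLevel p) :
    squeezeCube 1 p ∈ JSet i := by
  rw [mem_JSet_iff]
  rcases le_max_iff.1 hp with h | h
  · left
    by_contra hcon
    push Not at hcon
    have : ‖fun j : Fin i => (p j.castSucc : ℝ) - 1 / 2‖ < 1 / 4 := by
      rw [pi_norm_lt_iff (by norm_num)]
      intro j
      rw [Real.norm_eq_abs, abs_lt]
      by_contra hj
      rw [not_and_or, not_lt, not_lt] at hj
      rcases hj with hj | hj
      · refine (hcon j).1 ?_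
        rw [squeezeCube_castSucc]
        exact projIcc_of_le_left _ (by simp; linarith)
      · refine (hcon j).2 ?_
        rw [squeezeCube_castSucc]
        exact projIcc_of_right_le _ (by simp; linarith)
    linarith
  · right
    rw [squeezeCube_last]
    exact projIcc_of_right_le _ (by simp; linarith)

/-- Change the base point of a cube map along the path `w`. -/
def moveBase {X : Type*} {i : ℕ} (w : I → X) (h : Cube (i + 1) → X) (p : Cube (i + 1)) : X :=
  if outerLevel p ≤ 0 then h (squeezeCube 1 p) else w (projIcc 0 1 zero_le_one (outerLevel p))

section moveBase

variable {X : Type*} [TopologicalSpace X] {i : ℕ} {A B : Set X} {x y : X}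

theorem continuous_moveBase {Z : Type*} [TopologicalSpace Z] {H : Cube (i + 1) × Z → X}
    (hH : Continuous H) {W : I × Z → X} (hW : Continuous W)
    (hHW : ∀ z, ∀ p ∈ JSet i, H (p, z) = W (0, z)) :
    Continuous fun q : Cube (i + 1) × Z =>
      moveBase (fun s => W (s, q.2)) (fun p => H (p, q.2)) q.1 := by
  refine continuous_if_le (continuous_outerLevel.comp continuous_fst) continuous_const
    (Continuous.continuousOn ?_) (Continuous.continuousOn ?_) ?_
  · exact hH.comp ((continuous_squeezeCube.comp (continuous_fst.prodMk continuous_const)).prodMk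
      continuous_snd)
  · exact hW.comp ((continuous_projIcc.comp
      (continuous_outerLevel.comp continuous_fst)).prodMk continuous_snd)
  · intro q hq
    change H (squeezeCube 1 q.1, q.2) = W (projIcc 0 1 zero_le_one (outerLevel q.1), q.2)
    rw [hHW _ _ (squeezeCube_one_mem_JSet hq.ge), projIcc_of_le_left _ hq.le]
    rfl

theorem IsRelMap.moveBase {w : I → X} (hw : Continuous w) (hwB : ∀ s, w s ∈ B) (hBA : B ⊆ A)
    {h : Cube (i + 1) → X} (hh : IsRelMap i A B (w 0) h) :
    IsRelMap i A B (w 1) (moveBase w h) where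
  continuous := by
    have h1 : Continuous fun q : Cube (i + 1) × Unit => h q.1 := hh.continuous.comp continuous_fst
    have h2 : Continuous fun q : I × Unit => w q.1 := hw.comp continuous_fst
    have h3 : Continuous fun q : Cube (i + 1) × Unit => _root_.moveBase w h q.1 :=
      continuous_moveBase h1 h2 fun _ p hp => hh.eq_base_pt p hp
    exact h3.comp (f := fun p : Cube (i + 1) => (p, ()))
      (Continuous.prodMk continuous_id continuous_const)
  mem_total p := by
    unfold _root_.moveBase
    split_ifs
    · exact hh.mem_total _
    · exact hBA (hwB _)
  mem_base p hp := by
    unfold _root_.moveBase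
    split_ifs
    · exact hh.mem_base _ (by simp [hp])
    · exact hwB _
  eq_base_pt p hp := by
    have h1 := one_le_outerLevel hp
    unfold _root_.moveBase
    rw [if_neg (by linarith), projIcc_of_right_le _ h1]
    rfl

theorem IsRelMap.squeezeCube {h : Cube (i + 1) → X} (hh : IsRelMap i A B x h) (θ : I) :
    IsRelMap i A B x fun p => h (squeezeCube θ p) where
  continuous := hh.continuous.comp
    (continuous_squeezeCube.comp (continuous_id.prodMk continuous_const))
  mem_total _ := hh.mem_total _
  mem_base p hp := hh.mem_base _ (by simp [hp])
  eq_base_pt p hp := hh.eq_base_pt _ (squeezeCube_mem_JSet θ hp)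

theorem moveBase_const {h : Cube (i + 1) → X} (hh : IsRelMap i A B x h) :
    moveBase (fun _ => x) h = fun p => h (squeezeCube 1 p) := by
  funext p
  unfold moveBase
  split_ifs with hp
  · rfl
  · exact (hh.eq_base_pt _ (squeezeCube_one_mem_JSet (not_le.1 hp).le)).symm

theorem relHomotopic_squeezeCube {h : Cube (i + 1) → X} (hh : IsRelMap i A B x h) :
    RelHomotopic i A B x h fun p => h (squeezeCube 1 p) :=
  ⟨fun q => h (squeezeCube q.2 q.1), hh.continuous.comp continuous_squeezeCube, fun θ => hh.squeezeCube θ,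
    fun p => by simp only [squeezeCube_zero], fun _ => rfl⟩

/-- The map of relative homotopy classes changing the base point along `w`. -/
def RelPi.moveBase (w : I → X) (hw : Continuous w) (hwB : ∀ s, w s ∈ B) (hBA : B ⊆ A)
    (hx : w 0 = x) (hy : w 1 = y) : RelPi i A B x → RelPi i A B y :=
  Quot.map (fun h => ⟨_root_.moveBase w h.1, by
    subst hx hy; exact h.2.moveBase hw hwB hBA⟩) (by
    subst hx hy
    rintro ⟨h₀, hh₀⟩ ⟨h₁, hh₁⟩ ⟨H, hc, hsl, h0, h1⟩
    refine ⟨fun q => _root_.moveBase w (fun p => H (p, q.2)) q.1, ?_, ?_, ?_, ?_⟩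
    · exact continuous_moveBase hc (hw.comp continuous_fst)
        (fun z p hp => (hsl z).eq_base_pt p hp)
    · exact fun τ => (hsl τ).moveBase hw hwB hBA
    · intro p
      simp only [h0]
    · intro p
      simp only [h1])

theorem RelPi.moveBase_symm_moveBase (w : I → X) (hw : Continuous w) (hwB : ∀ s, w s ∈ B)
    (hBA : B ⊆ A) (hx : w 0 = x) (hy : w 1 = y) (w' : I → X) (hw' : Continuous w')
    (hwB' : ∀ s, w' s ∈ B) (hx' : w' 0 = y) (hy' : w' 1 = x) (hww : ∀ s, w' s = w (σ s))
    (c : RelPi i A B x) :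
    RelPi.moveBase w' hw' hwB' hBA hx' hy' (RelPi.moveBase w hw hwB hBA hx hy c) = c := by
  obtain ⟨h, hh⟩ := c
  have hh1 := hh.squeezeCube 1
  have h2 : RelHomotopic i A B x (fun p => h (_root_.squeezeCube 1 (_root_.squeezeCube 1 p)))
      (_root_.moveBase w' (_root_.moveBase w h)) := by
    subst hx
    refine ⟨fun q => _root_.moveBase (fun s => w (q.2 * σ s))
      (_root_.moveBase (fun s => w (q.2 * s)) h) q.1, ?_, ?_, ?_, ?_⟩
    · refine continuous_moveBase (H := fun q => _root_.moveBase (fun s => w (q.2 * s)) h q.1)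
        (W := fun q => w (q.2 * σ q.1)) ?_ (hw.comp (by fun_prop)) ?_
      · exact continuous_moveBase (H := fun q => h q.1) (W := fun q => w (q.2 * q.1))
          (hh.continuous.comp continuous_fst) (hw.comp (by fun_prop))
          (fun z p hp => by simpa using hh.eq_base_pt p hp)
      · intro z p hp
        have h1 := one_le_outerLevel hp
        simp only [_root_.moveBase]
        rw [if_neg (by linarith), projIcc_of_right_le _ h1]
        simp only [unitInterval.symm_zero]
        rfl
    · intro τ
      have e1 : IsRelMap i A B (w (τ * 1)) (_root_.moveBase (fun s => w (τ * s)) h) :=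
        IsRelMap.moveBase (w := fun s => w (τ * s)) (hw.comp (by fun_prop)) (fun _ => hwB _) hBA
          (by simpa using hh)
      have e2 := IsRelMap.moveBase (w := fun s => w (τ * σ s)) (hw.comp (by fun_prop))
        (fun _ => hwB _) hBA (h := _root_.moveBase (fun s => w (τ * s)) h) (by simpa using e1)
      simpa using e2
    · intro p
      simp only [zero_mul]
      rw [moveBase_const hh, moveBase_const hh1]
    · intro p
      simp only [one_mul]
      congr 1
      funext s
      exact (hww s).symm
  have e1 := Quot.sound (r := fun h₁ h₂ : {h : Cube (i + 1) → X // IsRelMap i A B x h} =>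
    RelHomotopic i A B x h₁.1 h₂.1) (a := ⟨h, hh⟩) (b := ⟨_, hh1⟩) (relHomotopic_squeezeCube hh)
  have e2 := Quot.sound (r := fun h₁ h₂ : {h : Cube (i + 1) → X // IsRelMap i A B x h} =>
    RelHomotopic i A B x h₁.1 h₂.1) (a := ⟨_, hh1⟩) (b := ⟨_, hh1.squeezeCube 1⟩)
    (relHomotopic_squeezeCube hh1)
  have e3 := Quot.sound (r := fun h₁ h₂ : {h : Cube (i + 1) → X // IsRelMap i A B x h} =>
    RelHomotopic i A B x h₁.1 h₂.1) (a := ⟨_, hh1.squeezeCube 1⟩)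
    (b := ⟨_root_.moveBase w' (_root_.moveBase w h), by
      subst hx hy
      have := (hh.moveBase hw hwB hBA)
      rw [← hx'] at this
      have := this.moveBase hw' hwB' hBA
      rwa [hy'] at this⟩) h2
  exact ((e1.trans e2).trans e3).symm

theorem RelPi.nonempty_equiv_of_joinedIn (hBA : B ⊆ A) (hxy : JoinedIn B x y) :
    Nonempty (RelPi i A B x ≃ RelPi i A B y) := by
  obtain ⟨w, hw⟩ := hxy
  refine ⟨⟨RelPi.moveBase w w.continuous hw hBA w.source w.target,
    RelPi.moveBase w.symm w.symm.continuous (fun s => hw _) hBA w.symm.source w.symm.target,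
    fun c => ?_, fun c => ?_⟩⟩
  · exact RelPi.moveBase_symm_moveBase _ _ _ _ _ _ _ _ _ _ _ (fun s => rfl) c
  · exact RelPi.moveBase_symm_moveBase _ _ _ _ _ _ _ _ _ _ _ (fun s => by simp) c

end moveBase

/-! ### Flowing along a lift of a constant vector field -/

section flow

variable {X Z : Type*} [NormedAddCommGroup X] [NormedSpace ℝ X]
  [NormedAddCommGroup Z] [NormedSpace ℝ Z]

/-- Near a compact set of regular points of `g`, a constant vector field `w` on the target lifts
to a compactly supported vector field. -/
theorem exists_vectorField_fderiv_eq [FiniteDimensional ℝ X] [FiniteDimensional ℝ Z]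
    {g : X → Z} (hg : ContDiff ℝ 2 g) {K : Set X}
    (hK : IsCompact K) (hKg : ∀ x ∈ K, Function.Surjective (fderiv ℝ g x)) (w : Z) :
    ∃ v : X → X, ContDiff ℝ 1 v ∧ HasCompactSupport v ∧
      ∃ U : Set X, IsOpen U ∧ K ⊆ U ∧ ∀ x ∈ U, fderiv ℝ g x (v x) = w := by
  have hL : ContDiff ℝ 1 (fderiv ℝ g) := hg.fderiv_right (by norm_num)
  have hloc : ∀ x, Function.Surjective (fderiv ℝ g x) → ∃ U : Set X, IsOpen U ∧ x ∈ U ∧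
      ∃ v : X → X, ContDiffOn ℝ 1 v U ∧ ∀ y ∈ U, fderiv ℝ g y (v y) = w := by
    intro x hx
    obtain ⟨S, hS⟩ := (fderiv ℝ g x).exists_rightInverse_of_surjective
      (LinearMap.range_eq_top.2 hx)
    have hM : ContDiff ℝ 1 fun y => (fderiv ℝ g y).comp S := hL.clm_comp contDiff_const
    refine ⟨{y | IsUnit ((fderiv ℝ g y).comp S : Z →L[ℝ] Z)},
      Units.isOpen.preimage hM.continuous, ?_,
      fun y => S (Ring.inverse ((fderiv ℝ g y).comp S : Z →L[ℝ] Z) w), ?_, ?_⟩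
    · rw [mem_ofPred_eq, hS]
      exact isUnit_one
    · intro y hy
      obtain ⟨u, hu⟩ := hy
      have h1 : ContDiffAt ℝ 1 (fun y => Ring.inverse ((fderiv ℝ g y).comp S : Z →L[ℝ] Z)) y := by
        refine ContDiffAt.comp (g := Ring.inverse) y ?_ hM.contDiffAt
        rw [← hu]
        exact contDiffAt_ringInverse ℝ u
      exact (S.contDiff.contDiffAt.comp y (h1.clm_apply contDiffAt_const)).contDiffWithinAt
    · intro y hy
      have := Ring.mul_inverse_cancel _ hy
      exact congrArg (fun F : Z →L[ℝ] Z => F w) this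
  have hUo : IsOpen {x | Function.Surjective (fderiv ℝ g x)} := by
    rw [isOpen_iff_mem_nhds]
    intro x hx
    obtain ⟨S, hS⟩ := (fderiv ℝ g x).exists_rightInverse_of_surjective
      (LinearMap.range_eq_top.2 hx)
    have hM : Continuous fun y => (fderiv ℝ g y).comp S :=
      (hL.clm_comp contDiff_const).continuous
    filter_upwards [(Units.isOpen.preimage hM).mem_nhds (show x ∈ _ ⁻¹' _ by
      rw [mem_preimage, hS]; exact isUnit_one)] with y hy z
    have := Ring.mul_inverse_cancel _ hy
    exact ⟨_, congrArg (fun F : Z →L[ℝ] Z => F z) this⟩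
  obtain ⟨K', hK', hKK', hK'U⟩ := exists_compact_between hK hUo hKg
  obtain ⟨K'', hK'', hKK'', -⟩ := exists_compact_between hK' isOpen_univ (subset_univ _)
  obtain ⟨v, hv⟩ := exists_contMDiffMap_forall_mem_convex_of_local (n := 1) (modelWithCornersSelf ℝ X)
    (t := fun x => {u : X | (x ∈ K' → fderiv ℝ g x u = w) ∧ (x ∉ K'' → u = 0)}) (by
      intro x u hu u' hu' a b ha hb hab
      refine ⟨fun hx => ?_, fun hx => ?_⟩
      · rw [map_add, map_smul, map_smul, hu.1 hx, hu'.1 hx, ← add_smul, hab, one_smul]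
      · rw [hu.2 hx, hu'.2 hx, smul_zero, smul_zero, add_zero]) (by
      intro x
      by_cases hx : x ∈ K'
      · obtain ⟨U, hU, hxU, v, hv, hvw⟩ := hloc x (hK'U hx)
        refine ⟨U ∩ interior K'', inter_mem (hU.mem_nhds hxU)
          (isOpen_interior.mem_nhds (hKK'' hx)), v, ?_, ?_⟩
        · exact (hv.mono inter_subset_left).contMDiffOn
        · exact fun y hy => ⟨fun _ => hvw y hy.1, fun h => absurd (interior_subset hy.2) h⟩
      · exact ⟨K'ᶜ, hK'.isClosed.isOpen_compl.mem_nhds hx, fun _ => 0, contMDiffOn_const,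
          fun y hy => ⟨fun h => absurd h hy, fun _ => rfl⟩⟩)
  refine ⟨v, v.contMDiff.contDiff, ?_, interior K', isOpen_interior, hKK', fun x hx =>
    (hv x).1 (interior_subset hx)⟩
  exact HasCompactSupport.intro hK'' fun x hx => (hv x).2 hx

/-- The flow of a compactly supported `C¹` vector field on a bounded set of initial conditions. -/
theorem exists_flow [CompleteSpace X] {v : X → X} (hv : ContDiff ℝ 1 v) (hvc : HasCompactSupport v) {r T : ℝ}
    (hr : 0 ≤ r) (hT : 0 ≤ T) :
    ∃ Φ : X × ℝ → X, ContinuousOn Φ (closedBall 0 r ×ˢ Icc 0 T) ∧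
      ∀ x ∈ closedBall (0 : X) r, Φ (x, 0) = x ∧
        ∀ t ∈ Icc 0 T, HasDerivWithinAt (fun s => Φ (x, s)) (v (Φ (x, t))) (Icc 0 T) t := by
  obtain ⟨C, hC⟩ := hv.lipschitzWith_of_hasCompactSupport hvc one_ne_zero
  obtain ⟨M, hM⟩ := hvc.exists_bound_of_continuous hv.continuous
  have hM0 : 0 ≤ M := (norm_nonneg _).trans (hM 0)
  lift M to NNReal using hM0
  lift r to NNReal using hr
  lift T to NNReal using hT
  have h0 : (0 : ℝ) ∈ Icc (0 : ℝ) T := ⟨le_rfl, T.2⟩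
  have hPL : IsPicardLindelof (fun _ => v) (⟨0, h0⟩ : Icc (0 : ℝ) T) (0 : X)
      (r + M * T) r M C :=
    IsPicardLindelof.of_time_independent (fun x _ => hM x) hC.lipschitzOnWith (by
      have : max ((T : ℝ) - 0) (0 - 0) = T := by simp
      push_cast
      rw [this]
      linarith)
  obtain ⟨Φ, hΦ, hΦc⟩ := hPL.exists_forall_mem_closedBall_eq_hasDerivWithinAt_continuousOn
  exact ⟨Φ, hΦc, hΦ⟩

theorem eq_add_smul_of_hasDerivWithinAt {g : X → Z} (hg : Differentiable ℝ g) {K U : Set X}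
    (hU : IsOpen U) (hKU : K ⊆ U) (hK : IsClosed K) {v : X → X} {w : Z}
    (hv : ∀ x ∈ U, fderiv ℝ g x (v x) = w) {φ : ℝ → X} {T : ℝ}
    (hφ : ∀ t ∈ Icc 0 T, HasDerivWithinAt φ (v (φ t)) (Icc 0 T) t)
    (hKT : ∀ t ∈ Icc 0 T, ∀ y, g y = g (φ 0) + t • w → y ∈ K) {t : ℝ} (ht : t ∈ Icc 0 T) :
    g (φ t) = g (φ 0) + t • w := by
  have hφc : ContinuousOn φ (Icc 0 T) := fun t ht => (hφ t ht).continuousWithinAt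
  have hT : 0 ≤ T := ht.1.trans ht.2
  have hconst : ∀ t ∈ Icc 0 T, (∀ s ∈ Ico 0 t, φ s ∈ U) → g (φ t) = g (φ 0) + t • w := by
    intro t ht hs
    have h2 : ∀ s ∈ Ico 0 t,
        HasDerivWithinAt (fun s => g (φ s) - s • w) 0 (Ici s) s := by
      intro s hs'
      have hd := (hφ s ⟨hs'.1, hs'.2.le.trans ht.2⟩)
      have hd2 : HasDerivWithinAt φ (v (φ s)) (Ici s) s := by
        refine (hd.mono (s := Icc s T) (Icc_subset_Icc_left hs'.1)).mono_of_mem_nhdsWithin ?_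
        exact Icc_mem_nhdsGE (hs'.2.trans_le ht.2)
      have h3 := ((hg (φ s)).hasFDerivAt.comp_hasDerivWithinAt s hd2).sub
        (((hasDerivAt_id s).smul_const w).hasDerivWithinAt (s := Ici s))
      rw [hv _ (hs s hs'), one_smul, sub_self] at h3
      exact h3
    have := constant_of_has_deriv_right_zero (f := fun s => g (φ s) - s • w) (a := 0) (b := t)
      ?_ h2 t ⟨ht.1, le_rfl⟩
    · simp only [zero_smul, sub_zero] at this
      rw [← this, sub_add_cancel]
    · exact (hg.continuous.comp_continuousOn (hφc.mono (Icc_subset_Icc_right ht.2))).sub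
        (by fun_prop)
  have h0 : φ 0 ∈ K := hKT 0 ⟨le_rfl, hT⟩ _ (by simp)
  have hsub : Icc 0 T ⊆ {t | φ t ∈ K} := by
    refine IsClosed.Icc_subset_of_forall_mem_nhdsGT_of_Icc_subset ?_ h0 ?_
    · have := hφc.preimage_isClosed_of_isClosed isClosed_Icc hK
      rwa [inter_comm] at this
    · intro t ht hts
      have htU : φ t ∈ U := hKU (hts ⟨ht.1, le_rfl⟩)
      have h1 : ∀ᶠ s in 𝓝[≥] t, φ s ∈ U := by
        have := ((hφc t ⟨ht.1, ht.2.le⟩).mono (Icc_subset_Icc_left ht.1)).eventually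
          (hU.mem_nhds htU)
        rwa [nhdsWithin_Icc_eq_nhdsGE ht.2] at this
      obtain ⟨u, hu, hus⟩ := (mem_nhdsGE_iff_exists_Ico_subset' ht.2).1 h1
      filter_upwards [Ioo_mem_nhdsGT (lt_min hu ht.2)] with s hs
      have hsT : s ∈ Icc 0 T := ⟨ht.1.trans hs.1.le, (hs.2.trans_le (min_le_right _ _)).le⟩
      refine hKT s hsT _ (hconst s hsT fun a ha => ?_)
      rcases le_total a t with hat | hat
      · exact hKU (hts ⟨ha.1, hat⟩)
      · exact hus ⟨hat, ha.2.trans (hs.2.trans_le (min_le_left _ _))⟩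
  exact hconst t ht fun s hs => hKU (hsub ⟨hs.1, hs.2.le.trans ht.2⟩)

end flow

/-- A retraction of the part of the tube `f ⁻¹' Γ` in a large ball to the part in a smaller ball,
preserving the fibers of `f`, when these fibers are transverse to the intermediate spheres. -/
theorem exists_fiberwise_radial_retraction {X Y : Type*} [NormedAddCommGroup X]
    [InnerProductSpace ℝ X] [FiniteDimensional ℝ X] [NormedAddCommGroup Y] [NormedSpace ℝ Y]
    [FiniteDimensional ℝ Y] {f : X → Y} (hf : ContDiff ℝ 2 f) {Γ : Set Y} (hΓ : IsClosed Γ)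
    {R ε : ℝ} (hR : 0 < R) (hε : 0 < ε)
    (htrans : ∀ x, f x ∈ Γ → R ≤ ‖x‖ → ‖x‖ ≤ R + ε →
      Function.Surjective (fderiv ℝ (fun y => (f y, ‖y‖ ^ 2)) x)) :
    ∃ ρ : X → X, ContinuousOn ρ (closedBall 0 (R + ε)) ∧ (∀ x ∈ closedBall 0 R, ρ x = x) ∧
      ∀ x ∈ closedBall 0 (R + ε), f x ∈ Γ → f (ρ x) = f x ∧ ρ x ∈ closedBall 0 R := by
  have hg : ContDiff ℝ 2 fun y : X => (f y, ‖y‖ ^ 2) := hf.prodMk (contDiff_norm_sq ℝ)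
  set K : Set X := closedBall 0 (R + ε) ∩ (f ⁻¹' Γ ∩ {x | R ≤ ‖x‖}) with hKdef
  have hK : IsCompact K := (isCompact_closedBall _ _).inter_right
    ((hΓ.preimage hf.continuous).inter (isClosed_le continuous_const continuous_norm))
  obtain ⟨v, hv, hvc, U, hU, hKU, hvU⟩ := exists_vectorField_fderiv_eq hg hK
    (fun x hx => htrans x hx.2.1 hx.2.2 (by simpa using hx.1)) ((0 : Y), (-1 : ℝ))
  have hT : 0 ≤ (R + ε) ^ 2 - R ^ 2 := by nlinarith
  obtain ⟨Φ, hΦc, hΦ⟩ := exists_flow hv hvc (add_pos hR hε).le hT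
  have hτ : ∀ x ∈ closedBall (0 : X) (R + ε),
      max 0 (‖x‖ ^ 2 - R ^ 2) ∈ Icc 0 ((R + ε) ^ 2 - R ^ 2) := by
    intro x hx
    rw [mem_closedBall_zero_iff] at hx
    refine ⟨le_max_left _ _, max_le hT ?_⟩
    nlinarith [norm_nonneg x]
  have hid : ∀ x ∈ closedBall (0 : X) R, Φ (x, max 0 (‖x‖ ^ 2 - R ^ 2)) = x := by
    intro x hx
    rw [mem_closedBall_zero_iff] at hx
    rw [max_eq_left (by nlinarith [norm_nonneg x])]
    exact (hΦ x (by rw [mem_closedBall_zero_iff]; linarith)).1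
  refine ⟨fun x => Φ (x, max 0 (‖x‖ ^ 2 - R ^ 2)), ?_, hid, ?_⟩
  · exact hΦc.comp (by fun_prop) fun x hx => ⟨hx, hτ x hx⟩
  · intro x hx hxΓ
    dsimp only
    rcases le_total ‖x‖ R with hxR | hxR
    · have hx1 : x ∈ closedBall (0 : X) R := by rwa [mem_closedBall_zero_iff]
      rw [hid x hx1]
      exact ⟨rfl, hx1⟩
    · have hle := hτ x hx
      rw [max_eq_right (by nlinarith)] at hle ⊢
      have hsub : Icc 0 (‖x‖ ^ 2 - R ^ 2) ⊆ Icc 0 ((R + ε) ^ 2 - R ^ 2) :=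
        Icc_subset_Icc_right hle.2
      have key := eq_add_smul_of_hasDerivWithinAt (hg.differentiable (by norm_num)) hU hKU
        hK.isClosed hvU (φ := fun t => Φ (x, t)) (T := ‖x‖ ^ 2 - R ^ 2)
        (fun t ht => ((hΦ x hx).2 t (hsub ht)).mono hsub) ?_ (right_mem_Icc.2 hle.1)
      · simp only [(hΦ x hx).1, Prod.smul_mk, smul_zero, Prod.mk_add_mk, add_zero, smul_eq_mul,
          Prod.mk.injEq] at key
        refine ⟨key.1, ?_⟩
        rw [mem_closedBall_zero_iff]
        refine abs_le_of_sq_le_sq' (by linarith [key.2]) hR.le |>.2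
      · intro t ht y hy
        simp only [(hΦ x hx).1, Prod.smul_mk, smul_zero, Prod.mk_add_mk, add_zero, smul_eq_mul,
          Prod.mk.injEq] at hy
        rw [mem_closedBall_zero_iff] at hx
        have h1 : ‖y‖ ≤ R + ε := by
          refine abs_le_of_sq_le_sq' ?_ (by linarith) |>.2
          nlinarith [ht.1, norm_nonneg x]
        have h2 : R ≤ ‖y‖ := by
          refine abs_le_of_sq_le_sq' ?_ (norm_nonneg y) |>.2
          linarith [ht.2]
        exact ⟨by rwa [mem_closedBall_zero_iff], by rw [mem_preimage, hy.1]; exact hxΓ, h2⟩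

/-! ### Transport in locally trivial families over the unit interval -/

theorem exists_transport {E : Type*} [TopologicalSpace E] {p : E → I} (hp : Continuous p)
    (hloc : ∀ s : I, ∃ O : Set I, IsOpen O ∧ s ∈ O ∧ ∃ L : E × I → E,
      ContinuousOn L {q | p q.1 ∈ O ∧ q.2 ∈ O} ∧
      (∀ x τ, p x ∈ O → τ ∈ O → p (L (x, τ)) = τ) ∧ ∀ x, p x ∈ O → L (x, p x) = x) :
    ∃ T : E × I → E, Continuous T ∧ (∀ x τ, p (T (x, τ)) = min (p x) τ) ∧
      ∀ x τ, p x ≤ τ → T (x, τ) = x := by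
  choose O hO hsO L hLc hLp hLx using hloc
  obtain ⟨t, ht0, htm, ⟨N, hN⟩, hsub⟩ :=
    exists_monotone_Icc_subset_open_cover_unitInterval hO
      (fun s _ => mem_iUnion.2 ⟨s, hsO s⟩)
  have key : ∀ k, ∃ T : E × I → E, ContinuousOn T {q | p q.1 ≤ t k} ∧
      (∀ x τ, p x ≤ t k → p (T (x, τ)) = min (p x) τ) ∧
      ∀ x τ, p x ≤ t k → p x ≤ τ → T (x, τ) = x := by
    intro k
    induction k with
    | zero =>
      rw [ht0]
      refine ⟨Prod.fst, continuousOn_fst, fun x τ hx => ?_, fun _ _ _ _ => rfl⟩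
      exact (min_eq_left (hx.trans unitInterval.nonneg')).symm
    | succ k ih =>
      obtain ⟨T, hTc, hTp, hTx⟩ := ih
      obtain ⟨s, hs⟩ := hsub k
      have hkk : t k ≤ t (k + 1) := htm (Nat.le_succ k)
      have hk : t k ∈ O s := hs ⟨le_rfl, hkk⟩
      have hpO : ∀ x, t k ≤ p x → p x ≤ t (k + 1) → p x ∈ O s := fun x h1 h2 => hs ⟨h1, h2⟩
      classical
      refine ⟨fun q => if p q.1 ≤ t k then T q else if q.2 ≤ t k then T (L s (q.1, t k), q.2)
        else L s (q.1, min (p q.1) q.2), ?_, ?_, ?_⟩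
      · have hC1 : IsClosed {q : E × I | p q.1 ≤ t k} :=
          isClosed_le (by fun_prop) continuous_const
        have hC2 : IsClosed {q : E × I | t k ≤ p q.1 ∧ p q.1 ≤ t (k + 1) ∧ q.2 ≤ t k} :=
          (isClosed_le continuous_const (by fun_prop)).inter
            ((isClosed_le (by fun_prop) continuous_const).inter
              (isClosed_le (by fun_prop) continuous_const))
        have hC3 : IsClosed {q : E × I | t k ≤ p q.1 ∧ p q.1 ≤ t (k + 1) ∧ t k ≤ q.2} :=
          (isClosed_le continuous_const (by fun_prop)).inter
            ((isClosed_le (by fun_prop) continuous_const).inter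
              (isClosed_le continuous_const (by fun_prop)))
        have e1 : ∀ x, p x = t k → L s (x, t k) = x := fun x hx => by
          rw [← hx]; exact hLx s x (hx ▸ hk)
        have c2 : ContinuousOn (fun q : E × I => T (L s (q.1, t k), q.2))
            {q : E × I | t k ≤ p q.1 ∧ p q.1 ≤ t (k + 1) ∧ q.2 ≤ t k} := by
          refine hTc.comp (((hLc s).comp (f := fun q : E × I => (q.1, t k)) (by fun_prop)
            ?_).prodMk continuousOn_snd) ?_
          · exact fun q hq => ⟨hpO _ hq.1 hq.2.1, hk⟩
          · exact fun q hq => (hLp s q.1 _ (hpO _ hq.1 hq.2.1) hk).le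
        have c3 : ContinuousOn (fun q : E × I => L s (q.1, min (p q.1) q.2))
            {q : E × I | t k ≤ p q.1 ∧ p q.1 ≤ t (k + 1) ∧ t k ≤ q.2} := by
          refine (hLc s).comp (f := fun q : E × I => (q.1, min (p q.1) q.2)) (by fun_prop) ?_
          exact fun q hq => ⟨hpO _ hq.1 hq.2.1,
            hs ⟨le_min hq.1 hq.2.2, (min_le_left _ _).trans hq.2.1⟩⟩
        refine (ContinuousOn.union_of_isClosed (ContinuousOn.union_of_isClosed
          (hTc.congr fun q hq => ?_) (c2.congr fun q hq => ?_) hC1 hC2)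
          (c3.congr fun q hq => ?_) (hC1.union hC2) hC3).mono ?_
        · exact if_pos hq
        · by_cases h : p q.1 ≤ t k
          · have := le_antisymm h hq.1
            simp only [h, if_true, e1 q.1 this]
          · simp only [h, hq.2.2, if_true, if_false]
        · by_cases h : p q.1 ≤ t k
          · have h1 := le_antisymm h hq.1
            simp only [h, if_true]
            rw [min_eq_left (h.trans hq.2.2), hLx s _ (h1 ▸ hk)]
            exact hTx q.1 q.2 h (h.trans hq.2.2)
          · by_cases h2 : q.2 ≤ t k
            · have h3 := le_antisymm h2 hq.2.2
              simp only [h, h2, if_true, if_false]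
              rw [h3, min_eq_right hq.1]
              have := hLp s q.1 _ (hpO _ hq.1 hq.2.1) hk
              exact hTx _ _ this.le this.le
            · simp only [h, h2, if_false]
        · intro q hq
          rcases le_total (p q.1) (t k) with h | h
          · exact Or.inl (Or.inl h)
          · rcases le_total q.2 (t k) with h2 | h2
            · exact Or.inl (Or.inr ⟨h, hq, h2⟩)
            · exact Or.inr ⟨h, hq, h2⟩
      · intro x τ hx
        dsimp only
        split_ifs with h h2
        · exact hTp x τ h
        · have h1 := hLp s x _ (hpO x (not_le.1 h).le hx) hk
          rw [hTp _ _ h1.le, h1, min_eq_right h2, min_eq_right (h2.trans (not_le.1 h).le)]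
        · exact hLp s _ _ (hpO x (not_le.1 h).le hx)
            (hs ⟨le_min (not_le.1 h).le (not_le.1 h2).le, (min_le_left _ _).trans hx⟩)
      · intro x τ hx hxτ
        dsimp only
        split_ifs with h h2
        · exact hTx x τ h hxτ
        · exact absurd (hxτ.trans h2) h
        · rw [min_eq_left hxτ]
          exact hLx s x (hpO x (not_le.1 h).le hx)
  obtain ⟨T, hTc, hTp, hTx⟩ := key N
  rw [hN N le_rfl] at hTc hTp hTx
  refine ⟨T, ?_, fun x τ => hTp x τ unitInterval.le_one', fun x τ => hTx x τ unitInterval.le_one'⟩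
  rw [← continuousOn_univ]
  exact hTc.mono fun q _ => unitInterval.le_one'

/-- A locally trivial family over an embedded arc, with total space mapping to the arc, carries a
transport towards the initial point of the arc. -/
theorem IsLocTrivOn.exists_transport {E Y : Type*} [TopologicalSpace E] [TopologicalSpace Y]
    [T2Space Y] {g : E → Y} (hg : Continuous g) {γ : I → Y} (hγc : Continuous γ)
    (hγi : Function.Injective γ) (hgγ : ∀ x, g x ∈ range γ) (h : IsLocTrivOn g (range γ)) :
    ∃ T : E × I → E, Continuous T ∧
      (∀ x s τ, g x = γ s → g (T (x, τ)) = γ (min s τ)) ∧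
      ∀ x s τ, g x = γ s → s ≤ τ → T (x, τ) = x := by
  have hemb : IsClosedEmbedding γ := hγc.isClosedEmbedding hγi
  choose p hp using hgγ
  have hpc : Continuous p := by
    rw [hemb.isInducing.continuous_iff]
    convert hg using 1
    exact funext hp
  obtain ⟨T, hTc, hTp, hTx⟩ := _root_.exists_transport hpc (fun s => by
    obtain ⟨V, hV, hsV, φ, hφ⟩ := h (γ s) ⟨s, rfl⟩
    have hx : ∀ x, p x ∈ γ ⁻¹' V → x ∈ g ⁻¹' (V ∩ range γ) := fun x hx =>
      ⟨by rw [← hp]; exact hx, hp x ▸ mem_range_self _⟩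
    classical
    refine ⟨γ ⁻¹' V, hV.preimage hγc, hsV, fun q =>
      if h : p q.1 ∈ γ ⁻¹' V ∧ q.2 ∈ γ ⁻¹' V then
        (φ.symm (⟨γ q.2, h.2, mem_range_self _⟩, (φ ⟨q.1, hx _ h.1⟩).2) : E) else q.1, ?_, ?_, ?_⟩
    · rw [continuousOn_iff_continuous_domRestrict]
      have : Continuous fun q : {q : E × I | p q.1 ∈ γ ⁻¹' V ∧ q.2 ∈ γ ⁻¹' V} =>
          (φ.symm (⟨γ q.1.2, q.2.2, mem_range_self _⟩, (φ ⟨q.1.1, hx _ q.2.1⟩).2) : E) := by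
        fun_prop
      refine this.congr fun q => ?_
      have hq : p q.1.1 ∈ γ ⁻¹' V ∧ q.1.2 ∈ γ ⁻¹' V := q.2
      rw [domRestrict_apply]
      split_ifs
      · rfl
    · intro x τ h1 h2
      apply hγi
      rw [hp]
      dsimp only
      rw [dif_pos ⟨h1, h2⟩, ← hφ, φ.apply_symm_apply]
    · intro x h1
      dsimp only
      rw [dif_pos ⟨h1, h1⟩]
      have : ((⟨γ (p x), h1, mem_range_self _⟩ : ↥(V ∩ range γ)), (φ ⟨x, hx _ h1⟩).2) =
          φ ⟨x, hx _ h1⟩ := Prod.ext (Subtype.ext (by rw [hφ]; exact hp x)) rfl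
      rw [this, φ.symm_apply_apply])
  have hps : ∀ x s, g x = γ s → p x = s := fun x s h => hγi ((hp x).trans h)
  refine ⟨T, hTc, fun x s τ h => ?_, fun x s τ h hs => hTx x τ ((hps x s h).le.trans hs)⟩
  rw [← hp, hTp, hps x s h]

theorem IsPolyMap.contDiff {m n : ℕ} {f : EuclideanSpace ℝ (Fin m) → EuclideanSpace ℝ (Fin n)}
    (hf : IsPolyMap f) {k : WithTop ℕ∞} : ContDiff ℝ k f := by
  rw [contDiff_euclidean]
  intro j
  obtain ⟨P, hP⟩ := hf j
  simp only [hP]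
  clear hP
  induction P using MvPolynomial.induction_on with
  | C a => simpa using contDiff_const
  | add p q hp hq => simpa using hp.add hq
  | mul_X p i hp =>
    simp only [map_mul, MvPolynomial.eval_X]
    exact hp.mul (by fun_prop)

/-- In the arc-and-ball setting, the part of the tube over the arc in the smaller ball deformation
retracts onto the part of the initial fiber in this ball. -/
theorem exists_tube_deformation {m n : ℕ}
    {f : EuclideanSpace ℝ (Fin m) → EuclideanSpace ℝ (Fin n)} (hf : IsPolyMap f)
    {γ : I → EuclideanSpace ℝ (Fin n)} (hγc : Continuous γ) (hγi : Function.Injective γ)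
    {R ε : ℝ} (hR : 0 < R) (hε : 0 < ε)
    (htrans : ∀ (s : I) (u : ℝ), u ∈ Set.Icc 0 ε → ∀ x, f x = γ s → ‖x‖ = R + u →
      Function.Surjective (fderiv ℝ (fun y => (f y, ‖y‖ ^ 2)) x))
    (hltB : IsLocTrivOn
      (fun x : ↥(f ⁻¹' (Set.range γ) ∩
          Metric.closedBall (0 : EuclideanSpace ℝ (Fin m)) (R + ε)) => f x.1)
      (Set.range γ)) :
    ∃ D : EuclideanSpace ℝ (Fin m) × I → EuclideanSpace ℝ (Fin m),
      ContinuousOn D ((f ⁻¹' range γ ∩ closedBall 0 R) ×ˢ univ) ∧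
      (∀ x ∈ f ⁻¹' range γ ∩ closedBall 0 R, D (x, 0) = x) ∧
      (∀ x ∈ f ⁻¹' range γ ∩ closedBall 0 R, ∀ t, D (x, t) ∈ f ⁻¹' range γ ∩ closedBall 0 R) ∧
      (∀ x ∈ f ⁻¹' {γ 0} ∩ closedBall 0 R, ∀ t, D (x, t) = x) ∧
      ∀ x ∈ f ⁻¹' range γ ∩ closedBall 0 R, D (x, 1) ∈ f ⁻¹' {γ 0} ∩ closedBall 0 R := by
  have hfc : ContDiff ℝ 2 f := hf.contDiff
  obtain ⟨ρ, hρc, hρid, hρ⟩ := exists_fiberwise_radial_retraction hfc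
    (isCompact_range hγc).isClosed hR hε (by
      rintro x ⟨s, hs⟩ h1 h2
      exact htrans s (‖x‖ - R) ⟨by linarith, by linarith⟩ x hs.symm (by ring))
  obtain ⟨T, hTc, hTf, hTx⟩ := hltB.exists_transport
    (hfc.continuous.comp continuous_subtype_val) hγc hγi fun x => x.2.1
  have hincl : f ⁻¹' range γ ∩ closedBall 0 R ⊆ f ⁻¹' range γ ∩ closedBall 0 (R + ε) :=
    inter_subset_inter_right _ (closedBall_subset_closedBall (by linarith))
  classical
  set D : EuclideanSpace ℝ (Fin m) × I → EuclideanSpace ℝ (Fin m) := fun q =>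
    if h : q.1 ∈ f ⁻¹' range γ ∩ closedBall 0 (R + ε) then ρ (T (⟨q.1, h⟩, σ q.2)).1 else q.1
    with hD
  have hDeq : ∀ x (h : x ∈ f ⁻¹' range γ ∩ closedBall 0 R) t,
      D (x, t) = ρ (T (⟨x, hincl h⟩, σ t)).1 := fun x h t => dif_pos (hincl h)
  have hDf : ∀ x ∈ f ⁻¹' range γ ∩ closedBall 0 R, ∀ s t, f x = γ s →
      f (D (x, t)) = γ (min s (σ t)) ∧ D (x, t) ∈ closedBall 0 R := by
    intro x hx s t hs
    rw [hDeq x hx]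
    have h1 := hρ _ (T (⟨x, hincl hx⟩, σ t)).2.2 (T (⟨x, hincl hx⟩, σ t)).2.1
    exact ⟨h1.1.trans (hTf ⟨x, hincl hx⟩ s (σ t) hs), h1.2⟩
  refine ⟨D, ?_, ?_, ?_, ?_, ?_⟩
  · rw [continuousOn_iff_continuous_domRestrict]
    have h1 : Continuous fun q : ↥((f ⁻¹' range γ ∩ closedBall 0 R) ×ˢ (univ : Set I)) =>
        ρ (T (⟨q.1.1, hincl q.2.1⟩, σ q.1.2)).1 := by
      refine hρc.comp_continuous (f := fun q : ↥((f ⁻¹' range γ ∩ closedBall 0 R) ×ˢ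
        (univ : Set I)) => (T (⟨q.1.1, hincl q.2.1⟩, σ q.1.2)).1) (by fun_prop) fun q => ?_
      exact (T (⟨q.1.1, hincl q.2.1⟩, σ q.1.2)).2.2
    exact h1.congr fun q => (hDeq q.1.1 q.2.1 q.1.2).symm
  · intro x hx
    obtain ⟨s, hs⟩ := hx.1
    rw [hDeq x hx, hTx ⟨x, hincl hx⟩ s (σ 0) hs.symm (by simpa using unitInterval.le_one')]
    exact hρid x hx.2
  · intro x hx t
    obtain ⟨s, hs⟩ := hx.1
    obtain ⟨h1, h2⟩ := hDf x hx s t hs.symm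
    exact ⟨⟨_, h1.symm⟩, h2⟩
  · intro x hx t
    have hx' : x ∈ f ⁻¹' range γ ∩ closedBall 0 R := ⟨⟨0, hx.1.symm⟩, hx.2⟩
    rw [hDeq x hx', hTx ⟨x, hincl hx'⟩ 0 (σ t) hx.1 unitInterval.nonneg']
    exact hρid x hx.2
  · intro x hx
    obtain ⟨s, hs⟩ := hx.1
    obtain ⟨h1, h2⟩ := hDf x hx s 1 hs.symm
    refine ⟨?_, h2⟩
    rw [mem_preimage, h1, unitInterval.symm_one, min_eq_right unitInterval.nonneg']
    rfl

/-! ### Counting distinct roots by polynomial conditions on the coefficients -/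

section Discriminants

open Polynomial

theorem det_powerSum_ne_zero {d r : ℕ} (α : Fin d → ℂ) (hr : (Finset.univ.image α).card = r) :
    (Matrix.of fun a b : Fin r => ∑ i, α i ^ (a + b : ℕ)).det ≠ 0 := by
  classical
  let e := (Finset.univ.image α).equivFinOfCardEq hr
  let β : Fin r → ℂ := fun j => (e.symm j : ℂ)
  let w : ℂ → ℂ := fun z => ((Finset.univ.filter fun i => α i = z).card : ℂ)
  have hM : (Matrix.of fun a b : Fin r => ∑ i, α i ^ (a + b : ℕ)) =
      (Matrix.vandermonde β).transpose * Matrix.diagonal (fun j => w (β j)) *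
        Matrix.vandermonde β := by
    ext a b
    rw [Matrix.mul_apply]
    simp only [Matrix.of_apply, Matrix.mul_diagonal, Matrix.transpose_apply,
      Matrix.vandermonde_apply]
    rw [Finset.sum_comp (fun z : ℂ => z ^ (a + b : ℕ)) α, ← Finset.sum_coe_sort,
      ← e.symm.sum_comp]
    refine Finset.sum_congr rfl fun j _ => ?_
    simp only [w, β, nsmul_eq_mul, pow_add]
    ring
  rw [hM, Matrix.det_mul, Matrix.det_mul, Matrix.det_transpose, Matrix.det_diagonal]
  have hV : (Matrix.vandermonde β).det ≠ 0 := by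
    rw [Matrix.det_vandermonde_ne_zero_iff]
    exact fun i j h => e.symm.injective (Subtype.ext h)
  refine mul_ne_zero (mul_ne_zero hV ?_) hV
  refine Finset.prod_ne_zero_iff.2 fun j _ => ?_
  obtain ⟨i, -, hi⟩ := Finset.mem_image.1 (e.symm j).2
  simp only [w, ne_eq, Nat.cast_eq_zero, Finset.card_eq_zero]
  exact Finset.nonempty_iff_ne_empty.1 ⟨i, by simp [β, hi]⟩

theorem det_powerSum_eq_zero {d k : ℕ} (α : Fin d → ℂ) (hk : (Finset.univ.image α).card < k) :
    (Matrix.of fun a b : Fin k => ∑ i, α i ^ (a + b : ℕ)).det = 0 := by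
  classical
  by_contra h
  let S := Finset.univ.image α
  let w : ℂ → ℂ := fun z => ((Finset.univ.filter fun i => α i = z).card : ℂ)
  let A : Matrix (Fin k) S ℂ := Matrix.of fun a z => (z : ℂ) ^ (a : ℕ)
  let B : Matrix S (Fin k) ℂ := Matrix.of fun z b => w z * (z : ℂ) ^ (b : ℕ)
  have hM : (Matrix.of fun a b : Fin k => ∑ i, α i ^ (a + b : ℕ)) = A * B := by
    ext a b
    rw [Matrix.mul_apply, Matrix.of_apply,
      Finset.sum_comp (fun z : ℂ => z ^ (a + b : ℕ)) α, ← Finset.sum_coe_sort]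
    refine Finset.sum_congr rfl fun j _ => ?_
    simp only [w, A, B, Matrix.of_apply, nsmul_eq_mul, pow_add]
    ring
  have h1 := Matrix.rank_of_isUnit _ ((Matrix.isUnit_iff_isUnit_det _).2 (isUnit_iff_ne_zero.2 h))
  rw [hM] at h1
  have h2 := (Matrix.rank_mul_le_left A B).trans A.rank_le_card_width
  rw [h1] at h2
  simp only [Fintype.card_fin, Fintype.card_coe, S] at h2
  omega

theorem exists_polynomial_det_powerSum (d k : ℕ) : ∃ Ψ : MvPolynomial (Fin d) ℝ,
    ∀ α : Fin d → ℂ, MvPolynomial.aeval (fun j : Fin d => (∏ i, (X - C (α i))).coeff j) Ψ =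
      (Matrix.of fun a b : Fin k => ∑ i, α i ^ (a + b : ℕ)).det := by
  classical
  let M : Matrix (Fin k) (Fin k) (MvPolynomial (Fin d) ℝ) :=
    Matrix.of fun a b => MvPolynomial.psum (Fin d) ℝ (a + b : ℕ)
  have hsym : M.det ∈ MvPolynomial.symmetricSubalgebra (Fin d) ℝ := by
    intro e
    rw [AlgHom.map_det]
    congr 1
    ext1 a b
    exact MvPolynomial.psum_isSymmetric (Fin d) ℝ _ e
  obtain ⟨P, hP⟩ := MvPolynomial.esymmAlgHom_surjective ℝ (n := d)
    (Fintype.card_fin d).le ⟨M.det, hsym⟩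
  refine ⟨MvPolynomial.aeval (fun i : Fin d =>
    (-1) ^ ((i : ℕ) + 1) * MvPolynomial.X (Fin.rev i)) P, fun α => ?_⟩
  have hP' : MvPolynomial.aeval (fun i : Fin d => MvPolynomial.esymm (Fin d) ℝ (i + 1)) P =
      M.det := by
    rw [← MvPolynomial.esymmAlgHom_apply, hP]
  have hL : MvPolynomial.aeval α M.det =
      (Matrix.of fun a b : Fin k => ∑ i, α i ^ (a + b : ℕ)).det := by
    rw [AlgHom.map_det]
    congr 1
    ext a b
    simp [M, MvPolynomial.psum]
  rw [← hL]
  clear hL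
  clear_value M
  rw [← hP', ← AlgHom.comp_apply, ← AlgHom.comp_apply]
  congr 1
  ext i
  simp only [AlgHom.comp_apply, MvPolynomial.aeval_X]
  rw [MvPolynomial.aeval_esymm_eq_multiset_esymm]
  have hprod : (∏ i, (X - C (α i))) = ((Finset.univ.val.map α).map fun t => X - C t).prod := by
    rw [Multiset.map_map]; rfl
  have hc : Multiset.card (Finset.univ.val.map α) = d := by simp
  simp only [map_mul, map_pow, map_neg, map_one, MvPolynomial.aeval_X]
  rw [hprod, Multiset.prod_X_sub_C_coeff _ (by rw [hc]; omega), hc, ← mul_assoc, ← pow_add]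
  have : d - (Fin.rev i : ℕ) = (i : ℕ) + 1 := by rw [Fin.val_rev]; omega
  rw [this, Even.neg_one_pow ⟨_, rfl⟩, one_mul]

/-- The complex roots of a real polynomial. -/
def complexRoots (p : ℝ[X]) : Finset ℂ := by
  classical exact (p.map (algebraMap ℝ ℂ)).roots.toFinset

theorem mem_complexRoots {p : ℝ[X]} (hp : p.Monic) {z : ℂ} :
    z ∈ complexRoots p ↔ (p.map (algebraMap ℝ ℂ)).eval z = 0 := by
  classical
  rw [complexRoots, Multiset.mem_toFinset, mem_roots (hp.map _).ne_zero, IsRoot.def]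

theorem exists_prod_eq_map {p : ℝ[X]} (hp : p.Monic) : ∃ α : Fin p.natDegree → ℂ,
    p.map (algebraMap ℝ ℂ) = ∏ i, (X - C (α i)) ∧
      ∀ z, z ∈ complexRoots p ↔ ∃ i, α i = z := by
  classical
  have hs := IsAlgClosed.splits (p.map (algebraMap ℝ ℂ))
  have hcard : Multiset.card (p.map (algebraMap ℝ ℂ)).roots = p.natDegree := by
    rw [← hs.natDegree_eq_card_roots, natDegree_map]
  have hL : (p.map (algebraMap ℝ ℂ)).roots.toList.length = p.natDegree := by simp [hcard]
  refine ⟨fun i => (p.map (algebraMap ℝ ℂ)).roots.toList.get (i.cast hL.symm), ?_, fun z => ?_⟩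
  · conv_lhs => rw [hs.eq_prod_roots_of_monic (hp.map _)]
    conv_lhs => rw [← Multiset.coe_toList (p.map (algebraMap ℝ ℂ)).roots]
    rw [Multiset.map_coe, Multiset.prod_coe, ← Fin.prod_univ_getElem]
    rw [← (finCongr (show p.natDegree = (List.map (fun a => X - C a)
      (p.map (algebraMap ℝ ℂ)).roots.toList).length by simp [hcard])).prod_comp]
    refine Finset.prod_congr rfl fun i _ => ?_
    simp
  · rw [complexRoots, Multiset.mem_toFinset, ← Multiset.mem_toList, List.mem_iff_get]
    exact ⟨fun ⟨n, hn⟩ => ⟨n.cast hL, by simpa using hn⟩, fun ⟨n, hn⟩ => ⟨_, hn⟩⟩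

/-- For monic real polynomials of degree `d`, the number of distinct complex roots is determined
by which of finitely many polynomials in the coefficients vanish. -/
theorem exists_discriminants (d : ℕ) : ∃ Ψ : ℕ → MvPolynomial (Fin d) ℝ, ∀ p q : ℝ[X],
    p.Monic → q.Monic → p.natDegree = d → q.natDegree = d →
    (∀ k ≤ d, MvPolynomial.eval (fun j : Fin d => p.coeff j) (Ψ k) = 0 ↔
      MvPolynomial.eval (fun j : Fin d => q.coeff j) (Ψ k) = 0) →
    (complexRoots p).card = (complexRoots q).card := by
  classical
  choose Ψ hΨ using exists_polynomial_det_powerSum d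
  have key : ∀ p : ℝ[X], p.Monic → p.natDegree = d → (complexRoots p).card ≤ d ∧
      MvPolynomial.eval (fun j : Fin d => p.coeff j) (Ψ (complexRoots p).card) ≠ 0 ∧
      ∀ k, (complexRoots p).card < k →
        MvPolynomial.eval (fun j : Fin d => p.coeff j) (Ψ k) = 0 := by
    rintro p hp rfl
    obtain ⟨α, hα, hroots⟩ := exists_prod_eq_map hp
    have himg : Finset.univ.image α = complexRoots p := by
      ext z; simp [hroots]
    have hev : ∀ k, ((MvPolynomial.eval (fun j : Fin p.natDegree => p.coeff j) (Ψ k) : ℝ) : ℂ) =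
        (Matrix.of fun a b : Fin k => ∑ i, α i ^ (a + b : ℕ)).det := by
      intro k
      rw [← hΨ, ← hα]
      simp only [coeff_map]
      exact (MvPolynomial.aeval_algebraMap_apply (A := ℝ) ℂ _ (Ψ k)).symm
    refine ⟨?_, ?_, fun k hk => ?_⟩
    · rw [← himg]; exact Finset.card_image_le.trans (by simp)
    · rw [← Complex.ofReal_ne_zero, hev]
      exact det_powerSum_ne_zero α (by rw [himg])
    · rw [← Complex.ofReal_eq_zero, hev]
      exact det_powerSum_eq_zero α (by rwa [himg])
  refine ⟨Ψ, fun p q hp hq hpd hqd h => ?_⟩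
  obtain ⟨p1, p2, p3⟩ := key p hp hpd
  obtain ⟨q1, q2, q3⟩ := key q hq hqd
  rcases lt_trichotomy (complexRoots p).card (complexRoots q).card with hlt | heq | hlt
  · exact absurd ((h _ q1).1 (p3 _ hlt)) q2
  · exact heq
  · exact absurd ((h _ p1).2 (q3 _ hlt)) p2

end Discriminants

/-! ### Continuity of the ordered real roots of a family of polynomials -/

section RootFunctions

open Polynomial

/-- The real roots of a real polynomial. -/
def realRoots (p : ℝ[X]) : Finset ℝ := p.roots.toFinset

theorem mem_realRoots {p : ℝ[X]} (hp : p.Monic) {w : ℝ} : w ∈ realRoots p ↔ p.eval w = 0 := by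
  rw [realRoots, Multiset.mem_toFinset, mem_roots hp.ne_zero, IsRoot.def]

theorem ofReal_mem_complexRoots {p : ℝ[X]} (hp : p.Monic) {w : ℝ} :
    (w : ℂ) ∈ complexRoots p ↔ w ∈ realRoots p := by
  rw [mem_complexRoots hp, mem_realRoots hp, ← Complex.coe_algebraMap, eval_map_algebraMap,
    aeval_algebraMap_apply, Complex.coe_algebraMap, Complex.ofReal_eq_zero, coe_aeval_eq_eval]

theorem conj_mem_complexRoots {p : ℝ[X]} (hp : p.Monic) {z : ℂ} (hz : z ∈ complexRoots p) :
    (starRingEnd ℂ) z ∈ complexRoots p := by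
  rw [mem_complexRoots hp, eval_map_algebraMap] at hz ⊢
  have := aeval_algHom_apply Complex.conjAe z p
  simp only [hz, map_zero, Complex.conjAe_coe] at this
  exact this

theorem exists_mem_complexRoots_norm_sub_lt {p : ℝ[X]} (hp : p.Monic) {z : ℂ} {η : ℝ}
    (hη : 0 < η) (h : ‖(p.map (algebraMap ℝ ℂ)).eval z‖ < η ^ p.natDegree) :
    ∃ b ∈ complexRoots p, ‖b - z‖ < η := by
  obtain ⟨α, hα, hroots⟩ := exists_prod_eq_map hp
  by_contra! hcon
  refine h.not_ge ?_
  rw [hα, eval_prod, norm_prod]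
  calc η ^ p.natDegree = ∏ _i : Fin p.natDegree, η := by simp
    _ ≤ _ := Finset.prod_le_prod (fun _ _ => hη.le) fun i _ => by
      rw [eval_sub, eval_X, eval_C, norm_sub_rev]
      exact hcon _ ((hroots _).2 ⟨i, rfl⟩)

theorem exists_pos_le_dist (S : Finset ℂ) : ∃ η : ℝ, 0 < η ∧
    (∀ β ∈ S, ∀ β' ∈ S, β ≠ β' → η ≤ ‖β - β'‖) ∧ ∀ β ∈ S, β.im ≠ 0 → η ≤ |β.im| := by
  have h1 : ∃ η : ℝ, 0 < η ∧ ∀ q ∈ S ×ˢ S, q.1 ≠ q.2 → η ≤ ‖q.1 - q.2‖ := by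
    induction S ×ˢ S using Finset.induction_on with
    | empty => exact ⟨1, one_pos, by simp⟩
    | insert q T hq ih =>
      obtain ⟨η, hη, h⟩ := ih
      by_cases hqq : q.1 = q.2
      · refine ⟨η, hη, fun r hr hne => ?_⟩
        rcases Finset.mem_insert.1 hr with rfl | hr
        · exact absurd hqq hne
        · exact h r hr hne
      · refine ⟨min η ‖q.1 - q.2‖, lt_min hη (norm_pos_iff.2 (sub_ne_zero.2 hqq)),
          fun r hr hne => ?_⟩
        rcases Finset.mem_insert.1 hr with rfl | hr
        · exact min_le_right _ _
        · exact (min_le_left _ _).trans (h r hr hne)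
  have h2 : ∃ η : ℝ, 0 < η ∧ ∀ β ∈ S, β.im ≠ 0 → η ≤ |β.im| := by
    clear h1
    induction S using Finset.induction_on with
    | empty => exact ⟨1, one_pos, by simp⟩
    | insert q T hq ih =>
      obtain ⟨η, hη, h⟩ := ih
      by_cases hqq : q.im = 0
      · refine ⟨η, hη, fun r hr hne => ?_⟩
        rcases Finset.mem_insert.1 hr with rfl | hr
        · exact absurd hqq hne
        · exact h r hr hne
      · refine ⟨min η |q.im|, lt_min hη (abs_pos.2 hqq), fun r hr hne => ?_⟩
        rcases Finset.mem_insert.1 hr with rfl | hr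
        · exact min_le_right _ _
        · exact (min_le_left _ _).trans (h r hr hne)
  obtain ⟨η, hη, h⟩ := h1
  obtain ⟨η', hη', h'⟩ := h2
  exact ⟨min η η', lt_min hη hη', fun β hβ β' hβ' hne =>
    (min_le_left _ _).trans (h (β, β') (Finset.mk_mem_product hβ hβ') hne),
    fun β hβ hne => (min_le_right _ _).trans (h' β hβ hne)⟩

variable {T : Type*} [TopologicalSpace T]

theorem continuous_eval_of_continuous_coeff {p : T → ℝ[X]} {d : ℕ}
    (hd : ∀ t, (p t).natDegree = d) (hc : ∀ k, Continuous fun t => (p t).coeff k) :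
    Continuous fun q : T × ℝ => (p q.1).eval q.2 := by
  simp only [eval_eq_sum_range, hd]
  exact continuous_finsetSum _ fun k _ =>
    ((hc k).comp continuous_fst).mul (continuous_snd.pow k)

theorem continuous_eval_map {p : T → ℝ[X]} {d : ℕ}
    (hd : ∀ t, (p t).natDegree = d) (hc : ∀ k, Continuous fun t => (p t).coeff k) (z : ℂ) :
    Continuous fun t => ((p t).map (algebraMap ℝ ℂ)).eval z := by
  simp only [eval_eq_sum_range, natDegree_map, hd, coeff_map]
  exact continuous_finsetSum _ fun k _ =>
    (Complex.continuous_ofReal.comp (hc k)).mul continuous_const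

/-- If the number of distinct complex roots is constant, then near a parameter `t₀` the real
roots correspond to those of `p t₀`, in the same order. -/
theorem eventually_exists_realRoots {p : T → ℝ[X]} {d : ℕ} (hp : ∀ t, (p t).Monic)
    (hd : ∀ t, (p t).natDegree = d) (hc : ∀ k, Continuous fun t => (p t).coeff k)
    (hcard : ∀ s t, (complexRoots (p s)).card = (complexRoots (p t)).card) (t₀ : T) {η : ℝ}
    (hη : 0 < η) : ∀ᶠ t in 𝓝 t₀, ∃ b : ℝ → ℝ,
      (∀ β ∈ realRoots (p t₀), b β ∈ realRoots (p t) ∧ |b β - β| < η) ∧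
      StrictMonoOn b (realRoots (p t₀)) ∧
      (realRoots (p t)).card = (realRoots (p t₀)).card := by
  classical
  obtain ⟨η₀, hη₀, hsep, him⟩ := exists_pos_le_dist (complexRoots (p t₀))
  let η' := min η (η₀ / 2)
  have hη' : 0 < η' := lt_min hη (half_pos hη₀)
  have hη'1 : η' ≤ η := min_le_left _ _
  have hη'2 : 2 * η' ≤ η₀ := by linarith [min_le_right η (η₀ / 2)]
  have hev : ∀ᶠ t in 𝓝 t₀, ∀ β ∈ complexRoots (p t₀), ∃ b ∈ complexRoots (p t), ‖b - β‖ < η' := by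
    rw [Filter.eventually_all_finset]
    intro β hβ
    have h0 : ‖((p t₀).map (algebraMap ℝ ℂ)).eval β‖ < η' ^ d := by
      rw [(mem_complexRoots (hp t₀)).1 hβ, norm_zero]
      positivity
    filter_upwards [(continuous_eval_map hd hc β).norm.continuousAt.eventually_lt
      continuousAt_const h0] with t ht
    exact exists_mem_complexRoots_norm_sub_lt (hp t) hη' (by rwa [hd])
  filter_upwards [hev] with t ht
  choose! c hcm hcn using ht
  have hinj : Set.InjOn c (complexRoots (p t₀)) := by
    intro β hβ β' hβ' h
    by_contra hne
    have h1 := hsep β hβ β' hβ' hne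
    have h2 : ‖β - β'‖ ≤ ‖c β - β‖ + ‖c β' - β'‖ := by
      rw [show β - β' = (c β' - β') - (c β - β) by rw [h]; ring, add_comm]
      exact norm_sub_le _ _
    linarith [hcn β hβ, hcn β' hβ']
  have himg : (complexRoots (p t₀)).image c = complexRoots (p t) := by
    refine Finset.eq_of_subset_of_card_le (Finset.image_subset_iff.2 hcm) ?_
    rw [Finset.card_image_of_injOn hinj, hcard]
  have hsurj : ∀ z ∈ complexRoots (p t), ∃ β ∈ complexRoots (p t₀), c β = z := by
    intro z hz
    rw [← himg] at hz
    simpa using hz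
  have huniq : ∀ β ∈ complexRoots (p t₀), ∀ z ∈ complexRoots (p t), ‖z - β‖ < η' → z = c β := by
    intro β hβ z hz hzβ
    obtain ⟨β', hβ', rfl⟩ := hsurj z hz
    by_contra hne
    have h1 := hsep β' hβ' β hβ fun h => hne (by rw [h])
    have h2 : ‖β' - β‖ ≤ ‖c β' - β‖ + ‖c β' - β'‖ := by
      rw [show β' - β = (c β' - β) - (c β' - β') by ring]
      exact norm_sub_le _ _
    linarith [hcn β' hβ']
  have hreal : ∀ β ∈ realRoots (p t₀), ((c β).re : ℂ) = c β := by
    intro β hβ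
    have hβ' := (ofReal_mem_complexRoots (hp t₀)).2 hβ
    rw [← Complex.conj_eq_iff_re]
    refine huniq _ hβ' _ (conj_mem_complexRoots (hp t) (hcm _ hβ')) ?_
    have : (starRingEnd ℂ) (c β) - β = (starRingEnd ℂ) (c β - β) := by simp
    rw [this, RCLike.norm_conj]
    exact hcn _ hβ'
  have hbm : ∀ β ∈ realRoots (p t₀), (c β).re ∈ realRoots (p t) ∧ |(c β).re - β| < η' := by
    intro β hβ
    have hβ' := (ofReal_mem_complexRoots (hp t₀)).2 hβ
    refine ⟨?_, ?_⟩
    · rw [← ofReal_mem_complexRoots (hp t), hreal β hβ]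
      exact hcm _ hβ'
    · have := hcn _ hβ'
      rw [← hreal β hβ, ← Complex.ofReal_sub, Complex.norm_real] at this
      exact this
  have hmono : StrictMonoOn (fun β : ℝ => (c β).re) (realRoots (p t₀)) := by
    intro β hβ β' hβ' hlt
    have h1 := hsep _ ((ofReal_mem_complexRoots (hp t₀)).2 hβ) _
      ((ofReal_mem_complexRoots (hp t₀)).2 hβ') (by exact_mod_cast hlt.ne)
    rw [← Complex.ofReal_sub, Complex.norm_real, Real.norm_eq_abs,
      abs_sub_comm, abs_of_pos (sub_pos.2 hlt)] at h1
    have h2 := abs_lt.1 (hbm β hβ).2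
    have h3 := abs_lt.1 (hbm β' hβ').2
    change (c β).re < (c β').re
    linarith
  refine ⟨fun β => (c β).re, fun β hβ => ⟨(hbm β hβ).1, (hbm β hβ).2.trans_le hη'1⟩, hmono, ?_⟩
  rw [← Finset.card_image_of_injOn hmono.injOn]
  congr 1
  ext w
  refine ⟨fun hw => ?_, fun hw => ?_⟩
  · obtain ⟨β, hβ, hβw⟩ := hsurj w ((ofReal_mem_complexRoots (hp t)).2 hw)
    have him0 : β.im = 0 := by
      by_contra hne
      have h1 := him β hβ hne
      have h2 := Complex.abs_im_le_norm (c β - β)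
      rw [hβw] at h2
      simp only [Complex.sub_im, Complex.ofReal_im, zero_sub, abs_neg] at h2
      have h3 := hcn β hβ
      rw [hβw] at h3
      linarith
    have hβre : β = (β.re : ℂ) := Complex.ext rfl (by simp [him0])
    refine Finset.mem_image.2 ⟨β.re, ?_, ?_⟩
    · rw [← ofReal_mem_complexRoots (hp t₀), ← hβre]; exact hβ
    · rw [← hβre, hβw, Complex.ofReal_re]
  · obtain ⟨β, hβ, rfl⟩ := Finset.mem_image.1 hw
    exact (hbm β hβ).1

/-- Over a connected base, the real roots of a monic family with constantly many distinct complex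
roots are enumerated increasingly by continuous functions. -/
theorem exists_continuous_root_enumeration [PreconnectedSpace T] [Nonempty T] {p : T → ℝ[X]}
    {d : ℕ} (hp : ∀ t, (p t).Monic) (hd : ∀ t, (p t).natDegree = d)
    (hc : ∀ k, Continuous fun t => (p t).coeff k)
    (hcard : ∀ s t, (complexRoots (p s)).card = (complexRoots (p t)).card) :
    ∃ (N : ℕ) (ξ : Fin N → T → ℝ), (∀ j, Continuous (ξ j)) ∧
      (∀ t, StrictMono fun j => ξ j t) ∧ ∀ t w, (p t).eval w = 0 ↔ ∃ j, ξ j t = w := by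
  classical
  have hloc : IsLocallyConstant fun t => (realRoots (p t)).card := by
    rw [IsLocallyConstant.iff_eventually_eq]
    intro t₀
    filter_upwards [eventually_exists_realRoots hp hd hc hcard t₀ one_pos] with t ht
    obtain ⟨b, -, -, h⟩ := ht
    exact h
  let t₁ : T := Classical.arbitrary T
  have hN : ∀ t, (realRoots (p t)).card = (realRoots (p t₁)).card := fun t =>
    hloc.apply_eq_of_preconnectedSpace t t₁
  refine ⟨_, fun j t => (realRoots (p t)).orderEmbOfFin (hN t) j, fun j => ?_, fun t =>
    ((realRoots (p t)).orderEmbOfFin (hN t)).strictMono, fun t w => ?_⟩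
  · rw [continuous_iff_continuousAt]
    intro t₀
    rw [ContinuousAt, Metric.tendsto_nhds]
    intro η hη
    filter_upwards [eventually_exists_realRoots hp hd hc hcard t₀ hη] with t ht
    obtain ⟨b, hb, hmono, -⟩ := ht
    have hu := Finset.orderEmbOfFin_unique (hN t)
      (f := fun j => b ((realRoots (p t₀)).orderEmbOfFin (hN t₀) j))
      (fun j => (hb _ (Finset.orderEmbOfFin_mem _ _ _)).1)
      (fun i j hij => hmono (Finset.orderEmbOfFin_mem _ _ _) (Finset.orderEmbOfFin_mem _ _ _)
        (((realRoots (p t₀)).orderEmbOfFin (hN t₀)).strictMono hij))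
    rw [← congrFun hu j, Real.dist_eq]
    exact (hb _ (Finset.orderEmbOfFin_mem _ _ _)).2
  · rw [← mem_realRoots (hp t)]
    have := Finset.range_orderEmbOfFin (realRoots (p t)) (hN t)
    rw [← Finset.mem_coe, ← this]
    rfl

/-- A continuous choice of roots over a connected base is one of the enumerating functions. -/
theorem exists_eq_of_continuous_choice [PreconnectedSpace T] [Nonempty T] {N : ℕ}
    {ξ : Fin N → T → ℝ} (hξ : ∀ j, Continuous (ξ j)) (hmono : ∀ t, StrictMono fun j => ξ j t)
    {ζ : T → ℝ} (hζ : Continuous ζ) (h : ∀ t, ∃ j, ξ j t = ζ t) : ∃ j, ∀ t, ξ j t = ζ t := by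
  have hclosed : ∀ j, IsClosed {t | ξ j t = ζ t} := fun j => isClosed_eq (hξ j) hζ
  obtain ⟨j, hj⟩ := h (Classical.arbitrary T)
  have hopen : IsOpen {t | ξ j t = ζ t} := by
    have : {t | ξ j t = ζ t} = (⋃ k ∈ {k : Fin N | k ≠ j}, {t | ξ k t = ζ t})ᶜ := by
      ext t
      simp only [mem_ofPred_eq, mem_compl_iff, mem_iUnion, not_exists]
      refine ⟨fun ht k hk hkt => hk ((hmono t).injective (hkt.trans ht.symm)), fun ht => ?_⟩
      obtain ⟨k, hk⟩ := h t
      by_contra hne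
      exact ht k (fun hkj => hne (hkj ▸ hk)) hk
    rw [this, isOpen_compl_iff]
    exact (Set.toFinite _).isClosed_biUnion fun k _ => hclosed k
  have := IsClopen.eq_univ ⟨hclosed j, hopen⟩ ⟨_, hj⟩
  exact ⟨j, fun t => (this ▸ mem_univ t : t ∈ {t | ξ j t = ζ t})⟩

end RootFunctions

/-! ### Lifting paths along root functions -/

section PathLifting

open Polynomial

/-- For finitely many polynomials, points near `z` can be joined to `z` by small paths along which,
except possibly at the endpoint `z`, none of the polynomials changes between vanishing and
non-vanishing. -/
def HasZeroPreservingPaths (n : ℕ) : Prop :=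
  ∀ (F : Finset (MvPolynomial (Fin n) ℝ)) (z : Fin n → ℝ), ∀ U ∈ 𝓝 z, ∃ W ∈ 𝓝 z, ∀ x ∈ W,
    ∃ c : I → (Fin n → ℝ), Continuous c ∧ c 0 = x ∧ c 1 = z ∧ (∀ t, c t ∈ U) ∧
      ∀ g ∈ F, ∀ s t : I, s ≠ 1 → t ≠ 1 →
        MvPolynomial.eval (c s) g = 0 → MvPolynomial.eval (c t) g = 0

variable {n : ℕ}

theorem exists_discriminants_of_family {h : (MvPolynomial (Fin n) ℝ)[X]} (hh : h.Monic) :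
    ∃ F : Finset (MvPolynomial (Fin n) ℝ), ∀ y y' : Fin n → ℝ,
      (∀ g ∈ F, MvPolynomial.eval y g = 0 ↔ MvPolynomial.eval y' g = 0) →
      (complexRoots (h.map (MvPolynomial.eval y))).card =
        (complexRoots (h.map (MvPolynomial.eval y'))).card := by
  classical
  obtain ⟨Ψ, hΨ⟩ := exists_discriminants h.natDegree
  let D : ℕ → MvPolynomial (Fin n) ℝ := fun k =>
    MvPolynomial.aeval (fun j : Fin h.natDegree => h.coeff j) (Ψ k)
  have hD : ∀ y k, MvPolynomial.eval y (D k) = MvPolynomial.eval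
      (fun j : Fin h.natDegree => (h.map (MvPolynomial.eval y)).coeff j) (Ψ k) := by
    intro y k
    simp only [D, coeff_map]
    rw [MvPolynomial.aeval_def, MvPolynomial.algebraMap_eq, ← MvPolynomial.coe_eval₂Hom,
      ← RingHom.comp_apply]
    congr 1
    ext i <;> simp
  refine ⟨(Finset.range (h.natDegree + 1)).image D, fun y y' hyy => ?_⟩
  refine hΨ _ _ (hh.map _) (hh.map _) (hh.natDegree_map _) (hh.natDegree_map _) fun k hk => ?_
  rw [← hD, ← hD]
  exact hyy _ (Finset.mem_image_of_mem _ (Finset.mem_range.2 (by omega)))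

theorem exists_root_enumeration_of_family {T : Type*} [TopologicalSpace T] [PreconnectedSpace T]
    [Nonempty T] {h : (MvPolynomial (Fin n) ℝ)[X]} (hh : h.Monic) {c : T → Fin n → ℝ}
    (hc : Continuous c)
    (hcard : ∀ s t, (complexRoots (h.map (MvPolynomial.eval (c s)))).card =
      (complexRoots (h.map (MvPolynomial.eval (c t)))).card) :
    ∃ (N : ℕ) (ξ : Fin N → T → ℝ), (∀ j, Continuous (ξ j)) ∧
      (∀ t, StrictMono fun j => ξ j t) ∧
      ∀ t w, (h.map (MvPolynomial.eval (c t))).eval w = 0 ↔ ∃ j, ξ j t = w := by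
  refine exists_continuous_root_enumeration (p := fun t => h.map (MvPolynomial.eval (c t)))
    (d := h.natDegree) (fun t => hh.map _) (fun t => hh.natDegree_map _) (fun k => ?_) hcard
  simp only [coeff_map]
  exact (MvPolynomial.continuous_eval _).comp hc

/-- A value between two constant roots is either a root, or lies strictly between two adjacent
root functions. -/
theorem exists_bracketing_roots {T : Type*} [TopologicalSpace T] [PreconnectedSpace T]
    [Nonempty T] {N : ℕ} {ξ : Fin N → T → ℝ} (hξ : ∀ j, Continuous (ξ j))
    (hmono : ∀ t, StrictMono fun j => ξ j t) {a b w : ℝ} (ha : ∀ t, ∃ j, ξ j t = a)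
    (hb : ∀ t, ∃ j, ξ j t = b) (haw : a < w) (hwb : w < b) (t₀ : T) :
    ∃ (j k : Fin N) (μ : ℝ), 0 ≤ μ ∧ μ ≤ 1 ∧ w = ξ j t₀ + μ * (ξ k t₀ - ξ j t₀) ∧
      (∀ t, a ≤ ξ j t) ∧ (∀ t, ξ j t < b) ∧ (∀ t, a < ξ k t) ∧ (∀ t, ξ k t ≤ b) ∧
      (j = k ∨ (0 < μ ∧ μ < 1 ∧ j < k ∧ ∀ i, i ≤ j ∨ k ≤ i)) := by
  obtain ⟨ia, hia⟩ := exists_eq_of_continuous_choice hξ hmono (continuous_const (y := a)) ha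
  obtain ⟨ib, hib⟩ := exists_eq_of_continuous_choice hξ hmono (continuous_const (y := b)) hb
  obtain ⟨j, hjw, hj⟩ := (Set.toFinite {j | ξ j t₀ ≤ w}).exists_maximal
    ⟨ia, ((hia t₀).trans_lt haw).le⟩
  obtain ⟨k, hkw, hk⟩ := (Set.toFinite {j | w ≤ ξ j t₀}).exists_minimal
    ⟨ib, (hwb.trans_eq (hib t₀).symm).le⟩
  simp only [mem_ofPred_eq] at hjw hj hkw hk
  have hlin : ∀ i, i ≤ j ∨ k ≤ i := fun i => by
    rcases le_total (ξ i t₀) w with h | h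
    · exact Or.inl ((le_total i j).elim id fun h' => hj h h')
    · exact Or.inr ((le_total k i).elim id fun h' => hk h h')
  have hjb : j < ib := (hmono t₀).lt_iff_lt.1 (show ξ j t₀ < ξ ib t₀ by rw [hib]; linarith)
  have hka : ia < k := (hmono t₀).lt_iff_lt.1 (show ξ ia t₀ < ξ k t₀ by rw [hia]; linarith)
  have haj : ia ≤ j := (hlin ia).elim id fun h => absurd h hka.not_ge
  have hkb : k ≤ ib := (hlin ib).elim (fun h => absurd h hjb.not_ge) id
  have h1 : ∀ t, a ≤ ξ j t := fun t => (hia t).symm.trans_le ((hmono t).monotone haj)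
  have h2 : ∀ t, ξ j t < b := fun t => (hmono t hjb).trans_eq (hib t)
  have h3 : ∀ t, a < ξ k t := fun t => (hia t).symm.trans_lt (hmono t hka)
  have h4 : ∀ t, ξ k t ≤ b := fun t => ((hmono t).monotone hkb).trans_eq (hib t)
  rcases eq_or_lt_of_le (hjw.trans hkw) with heq | hlt
  · have hjk : j = k := (hmono t₀).injective heq
    refine ⟨j, k, 0, le_rfl, zero_le_one, ?_, h1, h2, h3, h4, Or.inl hjk⟩
    rw [zero_mul, add_zero]
    exact le_antisymm (hkw.trans_eq heq.symm) hjw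
  · have hjk : j < k := (hmono t₀).lt_iff_lt.1 hlt
    have hd : 0 < ξ k t₀ - ξ j t₀ := sub_pos.2 hlt
    have hne1 : ξ j t₀ ≠ w := fun h => hjk.not_ge (hk h.ge hjk.le)
    have hne2 : w ≠ ξ k t₀ := fun h => hjk.not_ge (hj h.ge hjk.le)
    have hμ0 : 0 < (w - ξ j t₀) / (ξ k t₀ - ξ j t₀) :=
      div_pos (sub_pos.2 (lt_of_le_of_ne hjw hne1)) hd
    have hμ1 : (w - ξ j t₀) / (ξ k t₀ - ξ j t₀) < 1 := by
      rw [div_lt_one hd]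
      linarith [lt_of_le_of_ne hkw hne2]
    refine ⟨j, k, _, hμ0.le, hμ1.le, ?_, h1, h2, h3, h4, Or.inr ⟨hμ0, hμ1, hjk, hlin⟩⟩
    rw [div_mul_cancel₀ _ hd.ne']
    ring

instance preconnectedSpace_unitInterval_ne_one : PreconnectedSpace {s : I // s ≠ 1} := by
  have h : {s : I | s ≠ 1} = Iio 1 := by
    ext s
    exact ⟨fun hs => lt_of_le_of_ne le_top hs, fun hs => ne_of_lt hs⟩
  have : IsPreconnected {s : I | s ≠ 1} := h ▸ isPreconnected_Iio
  exact Subtype.preconnectedSpace this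

/-- Near the point `y₀`, all roots of a monic family in a punctured root-free interval at `y₀`
are close to its centre. -/
theorem eventually_abs_root_sub_lt {h : (MvPolynomial (Fin n) ℝ)[X]}
    (hh : h.Monic) {y₀ : Fin n → ℝ} {z₀ r : ℝ}
    (hr : ∀ w, (h.map (MvPolynomial.eval y₀)).eval w = 0 → |w - z₀| ≤ r → w = z₀) {η : ℝ}
    (hη : 0 < η) : ∀ᶠ y in 𝓝 y₀, ∀ w, (h.map (MvPolynomial.eval y)).eval w = 0 →
      |w - z₀| ≤ r → |w - z₀| < η := by
  have hcont : Continuous fun q : (Fin n → ℝ) × ℝ =>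
      (h.map (MvPolynomial.eval q.1)).eval q.2 :=
    continuous_eval_of_continuous_coeff (p := fun y => h.map (MvPolynomial.eval y))
      (d := h.natDegree) (fun y => hh.natDegree_map _) fun k => by
        simp only [coeff_map]
        exact MvPolynomial.continuous_eval _
  let K : Set ℝ := {w | |w - z₀| ≤ r ∧ η ≤ |w - z₀|}
  have hK : IsCompact K := by
    refine (isCompact_closedBall z₀ r).of_isClosed_subset ?_ fun w hw => ?_
    · have hd : Continuous fun w : ℝ => |w - z₀| := by fun_prop
      exact (isClosed_le hd continuous_const).inter (isClosed_le continuous_const hd)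
    · rw [mem_closedBall, Real.dist_eq]; exact hw.1
  have hev : ∀ᶠ y in 𝓝 y₀, ∀ w ∈ K, (h.map (MvPolynomial.eval y)).eval w ≠ 0 := by
    refine hK.eventually_forall_of_forall_eventually fun w hw => ?_
    refine hcont.continuousAt.eventually_ne fun h0 => ?_
    have := hr w h0 hw.1
    have h2 := hw.2
    rw [this, sub_self, abs_zero] at h2
    linarith
  filter_upwards [hev] with y hy w hw hwr
  by_contra! hcon
  exact hy w ⟨hwr, hcon⟩ hw

theorem exists_isolating_radius {p : ℝ[X]} (hp : p.Monic) (z₀ : ℝ) {ε : ℝ} (hε : 0 < ε) :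
    ∃ r, 0 < r ∧ r < ε ∧ ∀ w, p.eval w = 0 → |w - z₀| ≤ r → w = z₀ := by
  have : ∀ᶠ w in 𝓝[≠] z₀, p.eval w ≠ 0 := by
    have hfin : ({w | p.eval w = 0} : Set ℝ).Finite := by
      refine (realRoots p).finite_toSet.subset fun w hw => (mem_realRoots hp).2 hw
    have := (hfin.subset (sdiff_subset (t := {z₀}))).isClosed.isOpen_compl.mem_nhds
      (show z₀ ∈ ({w | p.eval w = 0} \ {z₀})ᶜ by simp)
    rw [eventually_nhdsWithin_iff]
    filter_upwards [this] with w hw hne h0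
    exact hw ⟨h0, hne⟩
  rw [eventually_nhdsWithin_iff, Metric.eventually_nhds_iff] at this
  obtain ⟨δ, hδ, h⟩ := this
  refine ⟨min δ ε / 2, by positivity, ?_, fun w hw hwr => ?_⟩
  · linarith [min_le_right δ ε]
  · by_contra hne
    refine h (y := w) ?_ hne hw
    rw [Real.dist_eq]
    have := lt_min hδ hε
    linarith [min_le_left δ ε]

theorem abs_convex_comb_sub_le {s q m z r η : ℝ} (hs0 : 0 ≤ s) (hs1 : s ≤ 1)
    (hq : |q - z| ≤ r) (hm : |m - z| ≤ η) :
    |(1 - s) * q + s * m - z| ≤ (1 - s) * r + s * η := by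
  rw [show (1 - s) * q + s * m - z = (1 - s) * (q - z) + s * (m - z) by ring]
  refine (abs_add_le _ _).trans ?_
  rw [abs_mul, abs_mul, abs_of_nonneg hs0, abs_of_nonneg (sub_nonneg.2 hs1)]
  gcongr

/-- Zero-preserving paths in the parameter space lift to the product with a line, for a finite
family of monic polynomials in the new variable. -/
theorem HasZeroPreservingPaths.exists_lift (hG : HasZeroPreservingPaths n)
    (S : Finset (MvPolynomial (Fin n) ℝ)[X]) (hS : ∀ h ∈ S, h.Monic) (y₀ : Fin n → ℝ) (z₀ : ℝ)
    {U : Set (Fin n → ℝ)} (hU : U ∈ 𝓝 y₀) {ε : ℝ} (hε : 0 < ε) :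
    ∃ W ∈ 𝓝 y₀, ∃ δ > 0, ∀ y ∈ W, ∀ w, |w - z₀| < δ →
      ∃ (c : I → Fin n → ℝ) (ω : I → ℝ), Continuous c ∧ Continuous ω ∧ c 0 = y ∧ ω 0 = w ∧
        c 1 = y₀ ∧ ω 1 = z₀ ∧ (∀ t, c t ∈ U) ∧ (∀ t, |ω t - z₀| < ε) ∧
        ∀ h ∈ S, ∀ s t : I, s ≠ 1 → t ≠ 1 →
          (h.map (MvPolynomial.eval (c s))).eval (ω s) = 0 →
          (h.map (MvPolynomial.eval (c t))).eval (ω t) = 0 := by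
  classical
  let P := ∏ h ∈ S, h
  have hP : P.Monic := monic_prod_of_monic _ _ hS
  obtain ⟨r, hr0, hrε, hr⟩ := exists_isolating_radius (hP.map (MvPolynomial.eval y₀)) z₀ hε
  let a := z₀ - r
  let b := z₀ + r
  let H := P * (X - C (MvPolynomial.C a)) * (X - C (MvPolynomial.C b))
  have hH : H.Monic := (hP.mul (monic_X_sub_C _)).mul (monic_X_sub_C _)
  have hHeval : ∀ y w, (H.map (MvPolynomial.eval y)).eval w =
      (P.map (MvPolynomial.eval y)).eval w * (w - a) * (w - b) := by
    intro y w
    simp [H]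
  have hSP : ∀ h ∈ S, ∀ y w, (h.map (MvPolynomial.eval y)).eval w = 0 →
      (P.map (MvPolynomial.eval y)).eval w = 0 := by
    intro h hh y w h0
    have hdvd : h.map (MvPolynomial.eval y) ∣ P.map (MvPolynomial.eval y) :=
      Polynomial.map_dvd _ (Finset.dvd_prod_of_mem _ hh)
    exact eval_eq_zero_of_dvd_of_eval_eq_zero hdvd h0
  have hF : ∀ h : (MvPolynomial (Fin n) ℝ)[X], ∃ F : Finset (MvPolynomial (Fin n) ℝ), h.Monic →
      ∀ y y' : Fin n → ℝ,
        (∀ g ∈ F, MvPolynomial.eval y g = 0 ↔ MvPolynomial.eval y' g = 0) →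
        (complexRoots (h.map (MvPolynomial.eval y))).card =
          (complexRoots (h.map (MvPolynomial.eval y'))).card := fun h => by
    by_cases hh : h.Monic
    · obtain ⟨F, hF⟩ := exists_discriminants_of_family hh
      exact ⟨F, fun _ => hF⟩
    · exact ⟨∅, fun h => absurd h hh⟩
  choose F hF using hF
  obtain ⟨W, hW, hpath⟩ := hG ((insert H S).biUnion F) y₀ U hU
  refine ⟨W, hW, r, hr0, fun y hy w hw => ?_⟩
  obtain ⟨c, hc, hc0, hc1, hcU, hcF⟩ := hpath y hy
  let T := {s : I // s ≠ 1}
  let t₀ : T := ⟨0, zero_ne_one⟩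
  have : Nonempty T := ⟨t₀⟩
  have henum : ∀ h ∈ insert H S, h.Monic → ∃ (N : ℕ) (ξ : Fin N → T → ℝ),
      (∀ j, Continuous (ξ j)) ∧ (∀ t, StrictMono fun j => ξ j t) ∧
      ∀ t w, (h.map (MvPolynomial.eval (c t.1))).eval w = 0 ↔ ∃ j, ξ j t = w := by
    intro h hh hm
    refine exists_root_enumeration_of_family hm (c := fun t : T => c t.1)
      (hc.comp continuous_subtype_val) fun s t => hF h hm _ _ fun g hg => ?_
    have hg' : g ∈ (insert H S).biUnion F := Finset.mem_biUnion.2 ⟨h, hh, hg⟩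
    exact ⟨hcF g hg' _ _ s.2 t.2, hcF g hg' _ _ t.2 s.2⟩
  obtain ⟨N, ξ, hξ, hmono, hroot⟩ := henum H (Finset.mem_insert_self _ _) hH
  obtain ⟨hw1, hw2⟩ := abs_lt.1 hw
  obtain ⟨j, k, μ, hμ0, hμ1, hwμ, haj, hjb, hak, hkb, hjk⟩ :=
    exists_bracketing_roots hξ hmono (a := a) (b := b) (w := w)
      (fun t => (hroot t a).1 (by rw [hHeval]; ring))
      (fun t => (hroot t b).1 (by rw [hHeval]; ring))
      (by simp only [a]; linarith) (by simp only [b]; linarith) t₀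
  have hle : ∀ t, ξ j t ≤ ξ k t := fun t => by
    rcases hjk with rfl | ⟨-, -, h, -⟩
    · exact le_rfl
    · exact (hmono t h).le
  let q : T → ℝ := fun s => ξ j s + μ * (ξ k s - ξ j s)
  let m : T → ℝ := fun s => max (ξ j s) (min z₀ (ξ k s))
  let v : T → ℝ := fun s => (1 - (s.1 : ℝ)) * q s + (s.1 : ℝ) * m s
  let ω : I → ℝ := fun s => if hs : s = 1 then z₀ else v ⟨s, hs⟩
  have hωv : ∀ s : T, ω s.1 = v s := fun s => dif_neg s.2
  have hω1 : ω 1 = z₀ := dif_pos rfl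
  have hqj : ∀ s, ξ j s ≤ q s := fun s => by
    have := mul_nonneg hμ0 (sub_nonneg.2 (hle s))
    simp only [q]; linarith
  have hqk : ∀ s, q s ≤ ξ k s := fun s => by
    have := mul_nonneg (sub_nonneg.2 hμ1) (sub_nonneg.2 (hle s))
    simp only [q]; linarith
  have hmj : ∀ s, ξ j s ≤ m s := fun s => le_max_left _ _
  have hmk : ∀ s, m s ≤ ξ k s := fun s => max_le (hle s) (min_le_right _ _)
  have hqr : ∀ s, |q s - z₀| ≤ r := fun s => by
    have h1 := haj s; have h2 := hkb s; have h3 := hqj s; have h4 := hqk s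
    rw [abs_le]
    constructor <;> linarith
  have hmr : ∀ s, |m s - z₀| ≤ r := fun s => by
    have h1 := haj s; have h2 := hkb s; have h3 := hmj s; have h4 := hmk s
    rw [abs_le]
    constructor <;> linarith
  have hvcont : Continuous v := by
    have h1 := hξ j
    have h2 := hξ k
    have h3 : Continuous fun s : T => (s.1 : ℝ) :=
      continuous_subtype_val.comp continuous_subtype_val
    exact ((continuous_const.sub h3).mul (h1.add (continuous_const.mul (h2.sub h1)))).add
      (h3.mul (h1.max (continuous_const.min h2)))
  have hlim : ∀ η > 0, ∀ᶠ s : I in 𝓝 1, ∀ hs : s ≠ 1, |m ⟨s, hs⟩ - z₀| ≤ η := by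
    intro η hη
    have h1 : Tendsto c (𝓝 1) (𝓝 y₀) := hc1 ▸ hc.continuousAt
    filter_upwards [h1.eventually (eventually_abs_root_sub_lt hP hr (lt_min hη hr0))] with s hs hs1
    have hbig : ∀ i, a ≤ ξ i ⟨s, hs1⟩ → ξ i ⟨s, hs1⟩ ≤ b →
        ξ i ⟨s, hs1⟩ = a ∨ ξ i ⟨s, hs1⟩ = b ∨ |ξ i ⟨s, hs1⟩ - z₀| < η := by
      intro i hi1 hi2
      have h0 := (hroot ⟨s, hs1⟩ _).2 ⟨i, rfl⟩
      rw [hHeval, mul_eq_zero, mul_eq_zero, sub_eq_zero, sub_eq_zero] at h0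
      rcases h0 with (h0 | h0) | h0
      · refine Or.inr (Or.inr ((hs _ h0 ?_).trans_le (min_le_left _ _)))
        rw [abs_le]
        constructor <;> linarith
      · exact Or.inl h0
      · exact Or.inr (Or.inl h0)
    have hjs := hle ⟨s, hs1⟩
    have hj' : ξ j ⟨s, hs1⟩ ≤ z₀ + η := by
      rcases hbig j (haj _) (hjb _).le with h | h | h
      · linarith
      · exact absurd h (hjb _).ne
      · linarith [(abs_lt.1 h).2]
    have hk' : z₀ - η ≤ ξ k ⟨s, hs1⟩ := by
      rcases hbig k (hak _).le (hkb _) with h | h | h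
      · exact absurd h (hak _).ne'
      · linarith
      · linarith [(abs_lt.1 h).1]
    rw [abs_le]
    constructor
    · have : z₀ - η ≤ m ⟨s, hs1⟩ := le_max_of_le_right (le_min (by linarith) hk')
      linarith
    · have : m ⟨s, hs1⟩ ≤ z₀ + η := max_le hj' ((min_le_left _ _).trans (by linarith))
      linarith
  have hωcont : Continuous ω := by
    rw [continuous_iff_continuousAt]
    intro s
    by_cases hs : s = 1
    · subst hs
      rw [ContinuousAt, hω1, Metric.tendsto_nhds]
      intro η hη
      have h1 : ∀ᶠ s : I in 𝓝 1, (1 - (s : ℝ)) * r < η / 2 := by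
        have : Continuous fun s : I => (1 - (s : ℝ)) * r := by fun_prop
        refine this.continuousAt.eventually_lt continuousAt_const ?_
        simp only [Set.Icc.coe_one, sub_self, zero_mul]
        exact half_pos hη
      filter_upwards [h1, hlim (η / 2) (half_pos hη)] with s hs1 hs2
      by_cases hs : s = 1
      · rw [hs, hω1, dist_self]; exact hη
      · have h3 := abs_convex_comb_sub_le s.2.1 s.2.2 (hqr ⟨s, hs⟩) (hs2 hs)
        rw [Real.dist_eq, hωv ⟨s, hs⟩]
        have h4 : (s : ℝ) * (η / 2) ≤ η / 2 := by nlinarith [s.2.2]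
        simp only [v]
        linarith
    · have hopen : IsOpen {s : I | s ≠ 1} := isOpen_ne
      have h1 := hopen.isOpenEmbedding_subtypeVal.continuousAt_iff (g := ω) (x := ⟨s, hs⟩)
      have h2 : ContinuousAt v ⟨s, hs⟩ := hvcont.continuousAt
      rw [← show (fun s : T => ω s.1) = v from funext hωv] at h2
      exact h1.1 h2
  refine ⟨c, ω, hc, hωcont, hc0, ?_, hc1, hω1, hcU, fun t => ?_, fun h hh s t hs ht h0 => ?_⟩
  · rw [hωv t₀, hwμ]
    simp [v, q, t₀]
  · by_cases ht : t = 1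
    · rw [ht, hω1, sub_self, abs_zero]; exact hε
    · rw [hωv ⟨t, ht⟩]
      have h3 := abs_convex_comb_sub_le t.2.1 t.2.2 (hqr ⟨t, ht⟩) (hmr ⟨t, ht⟩)
      simp only [v]
      linarith
  · have hHroot : ∀ t : T, ∀ w, (h.map (MvPolynomial.eval (c t.1))).eval w = 0 →
        ∃ i, ξ i t = w := fun t w h0 => (hroot t w).1 (by
      rw [hHeval, hSP h hh _ _ h0]; ring)
    have hvs := h0
    rw [hωv ⟨s, hs⟩] at hvs
    rw [hωv ⟨t, ht⟩]
    rcases hjk with rfl | ⟨hμ0', hμ1', hjk, hlin⟩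
    · have hv : ∀ s, v s = ξ j s := fun s => by
        have h1 : q s = ξ j s := le_antisymm (hqk s) (hqj s)
        have h2 : m s = ξ j s := le_antisymm (hmk s) (hmj s)
        simp only [v, h1, h2]
        ring
      rw [hv] at hvs ⊢
      obtain ⟨N', ζ, hζ, hζmono, hζroot⟩ := henum h (Finset.mem_insert_of_mem hh) (hS h hh)
      obtain ⟨i, hi⟩ := (hζroot ⟨s, hs⟩ _).1 hvs
      obtain ⟨i', hi'⟩ := exists_eq_of_continuous_choice hξ hmono (hζ i)
        fun t => hHroot t _ ((hζroot t _).2 ⟨i, rfl⟩)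
      have : i' = j := (hmono ⟨s, hs⟩).injective ((hi' _).trans hi)
      subst this
      exact (hζroot ⟨t, ht⟩ _).2 ⟨i, (hi' _).symm⟩
    · exfalso
      obtain ⟨i, hi⟩ := hHroot ⟨s, hs⟩ _ hvs
      have hs1 : (s : ℝ) < 1 := lt_of_le_of_ne s.2.2 fun h => hs (Subtype.ext h)
      have hs0 : (0 : ℝ) ≤ s := s.2.1
      have hjk' : ξ j ⟨s, hs⟩ < ξ k ⟨s, hs⟩ := hmono _ hjk
      have hq1 : ξ j ⟨s, hs⟩ < q ⟨s, hs⟩ := by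
        have := mul_pos hμ0' (sub_pos.2 hjk')
        simp only [q]; linarith
      have hq2 : q ⟨s, hs⟩ < ξ k ⟨s, hs⟩ := by
        have := mul_pos (sub_pos.2 hμ1') (sub_pos.2 hjk')
        simp only [q]; linarith
      have hm1 := hmj ⟨s, hs⟩
      have hm2 := hmk ⟨s, hs⟩
      have hv1 : ξ j ⟨s, hs⟩ < v ⟨s, hs⟩ := by
        have := mul_pos (sub_pos.2 hs1) (sub_pos.2 hq1)
        have := mul_nonneg hs0 (sub_nonneg.2 hm1)
        simp only [v]; linarith
      have hv2 : v ⟨s, hs⟩ < ξ k ⟨s, hs⟩ := by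
        have := mul_pos (sub_pos.2 hs1) (sub_pos.2 hq2)
        have := mul_nonneg hs0 (sub_nonneg.2 hm2)
        simp only [v]; linarith
      rcases hlin i with h | h
      · exact absurd ((hmono ⟨s, hs⟩).monotone h) (by simp only [hi]; exact hv1.not_ge)
      · exact absurd ((hmono ⟨s, hs⟩).monotone h) (by simp only [hi]; exact hv2.not_ge)

end PathLifting

/-! ### Shearing polynomials to monic ones -/

section Shear

open Polynomial

variable {n : ℕ}

/-- The substitution `(x₀, x) ↦ (w, y + w • v)`, viewed as a polynomial in `w`. -/
def shear (v : Fin n → ℝ) : MvPolynomial (Fin (n + 1)) ℝ →ₐ[ℝ] (MvPolynomial (Fin n) ℝ)[X] :=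
  MvPolynomial.aeval (Fin.cons X fun i => C (MvPolynomial.X i) + C (MvPolynomial.C (v i)) * X)

theorem eval_map_shear (v y : Fin n → ℝ) (w : ℝ) (g : MvPolynomial (Fin (n + 1)) ℝ) :
    ((shear v g).map (MvPolynomial.eval y)).eval w =
      MvPolynomial.eval (Fin.cons w (y + w • v) : Fin (n + 1) → ℝ) g := by
  let e : MvPolynomial (Fin (n + 1)) ℝ →+* ℝ :=
    ((evalRingHom w).comp (mapRingHom (MvPolynomial.eval y))).comp (shear v).toRingHom
  have : e = MvPolynomial.eval (Fin.cons w (y + w • v) : Fin (n + 1) → ℝ) := by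
    refine MvPolynomial.ringHom_ext (fun r => ?_) (fun i => ?_)
    · simp [e, shear, MvPolynomial.algebraMap_eq]
    · refine Fin.cases ?_ (fun i => ?_) i
      · simp [e, shear]
      · simp [e, shear]
        ring
  exact congrArg (fun φ => φ g) this

theorem shear_monomial (v : Fin n → ℝ) (s : Fin (n + 1) →₀ ℕ) :
    (shear v (MvPolynomial.monomial s 1)).natDegree ≤ s.degree ∧
      (shear v (MvPolynomial.monomial s 1)).coeff s.degree =
        MvPolynomial.C (MvPolynomial.eval (Fin.cons 1 v : Fin (n + 1) → ℝ)
          (MvPolynomial.monomial s 1)) := by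
  induction s using Finsupp.induction_linear with
  | zero =>
    have : (MvPolynomial.monomial 0 1 : MvPolynomial (Fin (n + 1)) ℝ) = 1 := rfl
    simp [this]
  | add s t hs ht =>
    have : (MvPolynomial.monomial (s + t) 1 : MvPolynomial (Fin (n + 1)) ℝ) =
        MvPolynomial.monomial s 1 * MvPolynomial.monomial t 1 := by
      rw [MvPolynomial.monomial_mul, one_mul]
    rw [this, map_mul, map_mul, map_mul, map_add]
    exact ⟨natDegree_mul_le_of_le hs.1 ht.1, by
      rw [coeff_mul_add_eq_of_natDegree_le hs.1 ht.1, hs.2, ht.2]⟩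
  | single i k =>
    have : (MvPolynomial.monomial (Finsupp.single i k) 1 : MvPolynomial (Fin (n + 1)) ℝ) =
        MvPolynomial.X i ^ k := by
      rw [MvPolynomial.X_pow_eq_monomial]
    have h1 : (shear v (MvPolynomial.X i)).natDegree ≤ 1 ∧
        (shear v (MvPolynomial.X i)).coeff 1 =
          MvPolynomial.C ((Fin.cons 1 v : Fin (n + 1) → ℝ) i) := by
      refine Fin.cases ?_ (fun i => ?_) i
      · simp [shear]
      · simp only [shear, MvPolynomial.aeval_X, Fin.cons_succ]
        refine ⟨?_, by simp⟩
        compute_degree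
    rw [this, map_pow, map_pow, map_pow, Finsupp.degree_single, MvPolynomial.eval_X]
    have h2 := natDegree_pow_le_of_le k h1.1
    have h3 := coeff_pow_of_natDegree_le (m := k) h1.1
    rw [mul_one] at h2 h3
    exact ⟨h2, by rw [h3, h1.2]⟩

theorem shear_natDegree_le_and_coeff (v : Fin n → ℝ) (g : MvPolynomial (Fin (n + 1)) ℝ) :
    (shear v g).natDegree ≤ g.totalDegree ∧
      (shear v g).coeff g.totalDegree =
        MvPolynomial.C (MvPolynomial.eval (Fin.cons 1 v : Fin (n + 1) → ℝ)
          (MvPolynomial.homogeneousComponent g.totalDegree g)) := by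
  classical
  have hg : shear v g = ∑ s ∈ g.support,
      C (MvPolynomial.C (g.coeff s)) * shear v (MvPolynomial.monomial s 1) := by
    conv_lhs => rw [g.as_sum, map_sum]
    refine Finset.sum_congr rfl fun s _ => ?_
    have : MvPolynomial.monomial s (g.coeff s) =
        g.coeff s • (MvPolynomial.monomial s 1 : MvPolynomial (Fin (n + 1)) ℝ) := by
      rw [MvPolynomial.smul_monomial, smul_eq_mul, mul_one]
    rw [this, map_smul, Algebra.smul_def]
    rfl
  have hdeg : ∀ s ∈ g.support, s.degree ≤ g.totalDegree := fun s hs =>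
    MvPolynomial.le_totalDegree hs
  constructor
  · rw [hg]
    refine natDegree_sum_le_of_forall_le _ _ fun s hs => ?_
    exact (natDegree_C_mul_le _ _).trans ((shear_monomial v s).1.trans (hdeg s hs))
  · rw [hg, finsetSum_coeff, MvPolynomial.homogeneousComponent_apply, map_sum, map_sum,
      Finset.sum_filter]
    refine Finset.sum_congr rfl fun s hs => ?_
    rw [coeff_C_mul]
    split_ifs with h
    · rw [← h, (shear_monomial v s).2, ← map_mul]
      rw [MvPolynomial.eval_monomial, MvPolynomial.eval_monomial, one_mul]
    · rw [coeff_eq_zero_of_natDegree_lt, mul_zero]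
      exact (shear_monomial v s).1.trans_lt (lt_of_le_of_ne (hdeg s hs) h)

theorem MvPolynomial.IsHomogeneous.eval_smul_eq {m d : ℕ} {g : MvPolynomial (Fin m) ℝ}
    (hg : g.IsHomogeneous d) (a : ℝ) (u : Fin m → ℝ) :
    MvPolynomial.eval (a • u) g = a ^ d * MvPolynomial.eval u g := by
  rw [MvPolynomial.eval_eq, MvPolynomial.eval_eq, Finset.mul_sum]
  refine Finset.sum_congr rfl fun s hs => ?_
  have hd : s.degree = d := by
    by_contra hne
    exact MvPolynomial.mem_support_iff.1 hs (hg.coeff_eq_zero hne)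
  simp only [Pi.smul_apply, smul_eq_mul, mul_pow, Finset.prod_mul_distrib]
  rw [Finset.prod_pow_eq_pow_sum]
  change _ * (a ^ s.degree * _) = _
  rw [hd]
  ring

theorem homogeneousComponent_totalDegree_ne_zero {m : ℕ} {g : MvPolynomial (Fin m) ℝ}
    (hg : g ≠ 0) : MvPolynomial.homogeneousComponent g.totalDegree g ≠ 0 := by
  obtain ⟨s, hs, hsd⟩ := Finset.exists_mem_eq_sup g.support
    (MvPolynomial.support_nonempty.2 hg) (fun s => s.sum fun _ e => e)
  intro h
  have h1 := congrArg (MvPolynomial.coeff s) h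
  rw [MvPolynomial.coeff_homogeneousComponent, if_pos, MvPolynomial.coeff_zero] at h1
  · exact MvPolynomial.mem_support_iff.1 hs h1
  · exact hsd.symm

/-- For a generic shear direction, finitely many nonzero polynomials become monic up to
a nonzero constant. -/
theorem exists_shear_monic (F : Finset (MvPolynomial (Fin (n + 1)) ℝ)) (hF : ∀ g ∈ F, g ≠ 0) :
    ∃ v : Fin n → ℝ, ∀ g ∈ F, ∃ a : ℝ, a ≠ 0 ∧ (C (MvPolynomial.C a) * shear v g).Monic := by
  classical
  let G : MvPolynomial (Fin (n + 1)) ℝ :=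
    (∏ g ∈ F, MvPolynomial.homogeneousComponent g.totalDegree g) * MvPolynomial.X 0
  have hG : G ≠ 0 := mul_ne_zero (Finset.prod_ne_zero_iff.2 fun g hg =>
    homogeneousComponent_totalDegree_ne_zero (hF g hg)) (MvPolynomial.X_ne_zero _)
  obtain ⟨u, hu⟩ : ∃ u, MvPolynomial.eval u G ≠ 0 := by
    by_contra! h
    exact hG (MvPolynomial.funext fun x => by rw [h, map_zero])
  simp only [G, map_mul, map_prod, MvPolynomial.eval_X] at hu
  have hu0 : u 0 ≠ 0 := right_ne_zero_of_mul hu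
  have huF := Finset.prod_ne_zero_iff.1 (left_ne_zero_of_mul hu)
  refine ⟨fun i => u i.succ / u 0, fun g hg => ?_⟩
  set v : Fin n → ℝ := fun i => u i.succ / u 0
  have huv : u = u 0 • (Fin.cons 1 v : Fin (n + 1) → ℝ) := by
    ext i
    refine Fin.cases ?_ (fun i => ?_) i
    · simp
    · simp [v, mul_div_cancel₀ _ hu0]
  obtain ⟨h1, h2⟩ := shear_natDegree_le_and_coeff v g
  have hne : MvPolynomial.eval (Fin.cons 1 v : Fin (n + 1) → ℝ)
      (MvPolynomial.homogeneousComponent g.totalDegree g) ≠ 0 := by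
    have h := huF g hg
    rw [huv, (MvPolynomial.homogeneousComponent_isHomogeneous _ g).eval_smul_eq] at h
    exact right_ne_zero_of_mul h
  refine ⟨_, inv_ne_zero hne, ?_⟩
  refine monic_of_natDegree_le_of_coeff_eq_one g.totalDegree
    ((natDegree_C_mul_le _ _).trans h1) ?_
  rw [coeff_C_mul, h2, ← map_mul, inv_mul_cancel₀ hne, map_one]

theorem HasZeroPreservingPaths.succ (hG : HasZeroPreservingPaths n) :
    HasZeroPreservingPaths (n + 1) := by
  classical
  intro F z U hU
  obtain ⟨v, hv⟩ := exists_shear_monic (F.filter (· ≠ 0)) fun g hg => (Finset.mem_filter.1 hg).2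
  choose! a ha hmonic using hv
  let h : MvPolynomial (Fin (n + 1)) ℝ → (MvPolynomial (Fin n) ℝ)[X] := fun g =>
    C (MvPolynomial.C (a g)) * shear v g
  let φ : (Fin n → ℝ) × ℝ → (Fin (n + 1) → ℝ) := fun q => Fin.cons q.2 (q.1 + q.2 • v)
  let ψ : (Fin (n + 1) → ℝ) → (Fin n → ℝ) := fun x i => x i.succ - x 0 * v i
  have hφ : Continuous φ := by
    have h1 : Continuous fun q : (Fin n → ℝ) × ℝ => q.1 + q.2 • v := by fun_prop
    exact Continuous.finCons (A := fun _ => ℝ) continuous_snd h1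
  have hψ : Continuous ψ := by fun_prop
  have hφψ : ∀ x, φ (ψ x, x 0) = x := fun x => by
    ext i
    refine Fin.cases ?_ (fun i => ?_) i
    · simp [φ]
    · simp [φ, ψ]
  have heval : ∀ g y w, ((h g).map (MvPolynomial.eval y)).eval w =
      a g * MvPolynomial.eval (φ (y, w)) g := fun g y w => by
    simp only [h, φ, Polynomial.map_mul, Polynomial.map_C, eval_mul, eval_C,
      MvPolynomial.eval_C, eval_map_shear]
  have hU' : φ ⁻¹' U ∈ 𝓝 (ψ z, z 0) := hφ.continuousAt.preimage_mem_nhds (by rwa [hφψ])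
  obtain ⟨U₁, hU₁, U₂, hU₂, hUU⟩ := mem_nhds_prod_iff.1 hU'
  obtain ⟨ε, hε, hεU⟩ := Metric.mem_nhds_iff.1 hU₂
  obtain ⟨W, hW, δ, hδ, hpath⟩ := hG.exists_lift ((F.filter (· ≠ 0)).image h)
    (by
      intro p hp
      obtain ⟨g, hg, rfl⟩ := Finset.mem_image.1 hp
      exact hmonic g hg) (ψ z) (z 0) hU₁ hε
  have hnhds : {x : Fin (n + 1) → ℝ | ψ x ∈ W ∧ |x 0 - z 0| < δ} ∈ 𝓝 z := by
    refine Filter.inter_mem (hψ.continuousAt.preimage_mem_nhds hW) ?_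
    have hc : Continuous fun x : Fin (n + 1) → ℝ => |x 0 - z 0| := by fun_prop
    exact hc.continuousAt.eventually_lt continuousAt_const (by simpa using hδ)
  refine ⟨_, hnhds, fun x hx => ?_⟩
  obtain ⟨c, ω, hc, hω, hc0, hω0, hc1, hω1, hcU, hωε, hcω⟩ := hpath _ hx.1 _ hx.2
  refine ⟨fun t => φ (c t, ω t), hφ.comp (hc.prodMk hω), ?_, ?_, fun t => ?_,
    fun g hg s t hs ht h0 => ?_⟩
  · simp only [hc0, hω0, hφψ]
  · simp only [hc1, hω1, hφψ]
  · refine hUU (mk_mem_prod (hcU t) (hεU ?_))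
    rw [mem_ball, Real.dist_eq]
    exact hωε t
  · by_cases hg0 : g = 0
    · rw [hg0, map_zero]
    · have hg' : g ∈ F.filter (· ≠ 0) := Finset.mem_filter.2 ⟨hg, hg0⟩
      have h1 := hcω (h g) (Finset.mem_image_of_mem _ hg') s t hs ht
      rw [heval, heval, mul_eq_zero, mul_eq_zero] at h1
      exact (h1 (Or.inr h0)).resolve_left (ha g hg')

theorem hasZeroPreservingPaths (n : ℕ) : HasZeroPreservingPaths n := by
  induction n with
  | zero =>
    intro F z U hU
    refine ⟨univ, univ_mem, fun x _ => ⟨fun _ => z, continuous_const, Subsingleton.elim _ _, rfl,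
      fun _ => mem_of_mem_nhds hU, fun g _ s t _ _ h => h⟩⟩
  | succ n ih => exact ih.succ

end Shear

/-! ### Path components of polynomial fibers in a ball -/

theorem joinedIn_of_mem_connectedComponentIn {X : Type*} [TopologicalSpace X] {V : Set X}
    (hV : ∀ z ∈ V, ∃ W ∈ 𝓝 z, ∀ x ∈ W ∩ V, JoinedIn V x z) {x y : X} (hx : x ∈ V)
    (hy : y ∈ connectedComponentIn V x) : JoinedIn V x y := by
  have hsub := connectedComponentIn_subset V x
  refine isPreconnected_connectedComponentIn.induction₂ (JoinedIn V) (fun z hz => ?_)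
    (fun _ _ _ _ _ _ h h' => h.trans h') (fun _ _ _ _ h => h.symm)
    (mem_connectedComponentIn hx) hy
  obtain ⟨W, hW, hj⟩ := hV z (hsub hz)
  filter_upwards [mem_nhdsWithin_of_mem_nhds hW, self_mem_nhdsWithin] with a ha haC
  exact (hj a ⟨ha, hsub haC⟩).symm

theorem IsPolyMap.exists_nhds_joinedIn {m n : ℕ}
    {f : EuclideanSpace ℝ (Fin m) → EuclideanSpace ℝ (Fin n)} (hf : IsPolyMap f)
    (t₀ : EuclideanSpace ℝ (Fin n)) {R : ℝ} (hR : 0 ≤ R) :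
    ∀ z ∈ f ⁻¹' {t₀} ∩ closedBall (0 : EuclideanSpace ℝ (Fin m)) R, ∃ W ∈ 𝓝 z,
      ∀ x ∈ W ∩ (f ⁻¹' {t₀} ∩ closedBall (0 : EuclideanSpace ℝ (Fin m)) R),
        JoinedIn (f ⁻¹' {t₀} ∩ closedBall (0 : EuclideanSpace ℝ (Fin m)) R) x z := by
  classical
  choose p hp using hf
  let P : MvPolynomial (Fin m) ℝ := ∑ j, (p j - MvPolynomial.C (t₀ j)) ^ 2
  let Q : MvPolynomial (Fin m) ℝ := ∑ k, MvPolynomial.X k ^ 2 - MvPolynomial.C (R ^ 2)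
  have hPQ : ∀ x : EuclideanSpace ℝ (Fin m),
      x ∈ f ⁻¹' {t₀} ∩ closedBall (0 : EuclideanSpace ℝ (Fin m)) R ↔
        MvPolynomial.eval (fun k => x k) P = 0 ∧ MvPolynomial.eval (fun k => x k) Q ≤ 0 := by
    intro x
    refine and_congr ?_ ?_
    · simp only [P, map_sum, map_pow, map_sub, MvPolynomial.eval_C, ← hp]
      rw [Finset.sum_eq_zero_iff_of_nonneg fun j _ => sq_nonneg _]
      simp only [Finset.mem_univ, true_imp_iff, sq_eq_zero_iff, sub_eq_zero]
      exact ⟨fun h j => congrArg (fun y : EuclideanSpace ℝ (Fin n) => y j) h,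
        fun h => PiLp.ext h⟩
    · simp only [Q, map_sum, map_pow, map_sub, MvPolynomial.eval_C, MvPolynomial.eval_X]
      rw [mem_closedBall_zero_iff, sub_nonpos, ← EuclideanSpace.real_norm_sq_eq,
        sq_le_sq₀ (norm_nonneg _) hR]
  intro z hz
  obtain ⟨W, hW, hpath⟩ := hasZeroPreservingPaths m {P, Q} (fun k => z k) univ univ_mem
  have hcont : Continuous fun (x : EuclideanSpace ℝ (Fin m)) (k : Fin m) => x k := by fun_prop
  refine ⟨_, hcont.continuousAt.preimage_mem_nhds hW, fun x hx => ?_⟩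
  obtain ⟨c, hc, hc0, hc1, -, hF⟩ := hpath _ hx.1
  have hx0 := (hPQ x).1 hx.2
  have hz0 := (hPQ z).1 hz
  have hmem : ∀ t, WithLp.toLp 2 (c t) ∈
      f ⁻¹' {t₀} ∩ closedBall (0 : EuclideanSpace ℝ (Fin m)) R := by
    intro t
    rw [hPQ]
    change MvPolynomial.eval (c t) P = 0 ∧ MvPolynomial.eval (c t) Q ≤ 0
    by_cases ht : t = 1
    · rw [ht, hc1]; exact hz0
    refine ⟨hF P (by simp) 0 t zero_ne_one ht (by rw [hc0]; exact hx0.1), ?_⟩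
    by_contra! hpos
    have hQc : Continuous fun t => MvPolynomial.eval (c t) Q :=
      (MvPolynomial.continuous_eval Q).comp hc
    obtain ⟨s, hs, hs0⟩ := intermediate_value_Icc (show (0 : I) ≤ t from bot_le)
      hQc.continuousOn ⟨by rw [hc0]; exact hx0.2, hpos.le⟩
    have hs1 : s ≠ 1 := fun h => ht (le_antisymm le_top (h ▸ hs.2))
    exact hpos.ne' (hF Q (by simp) s t hs1 ht hs0)
  exact ⟨⟨⟨fun t => WithLp.toLp 2 (c t), (PiLp.continuous_toLp 2 _).comp hc⟩,
    by simp only [hc0], by simp only [hc1]⟩, hmem⟩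

/-- **Lemma 3.5 (Lemma 27).** In the arc-and-ball setting, the inclusion
`E^R_0 ⊆ E^R_{[0,1]}` induces an isomorphism
`π_{i+1}(E⁻_{[0,1]}, E^R_0, x0^R) ≅ π_{i+1}(E⁻_{[0,1]}, E^R_{[0,1]}, x*^R)` for every `i`,
every `x0^R ∈ E^R_0` and every `x*^R ∈ E^R_{[0,1]}` lying in the connected component of
`E^R_{[0,1]}` containing `x0^R`. -/
theorem relPi_incl_bijective_ER0_ER01
    (m n : ℕ) (hmn : n < m)
    (f : EuclideanSpace ℝ (Fin m) → EuclideanSpace ℝ (Fin n)) (hf : IsPolyMap f)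
    (γ : I → EuclideanSpace ℝ (Fin n)) (hγc : Continuous γ)
    (hγi : Function.Injective γ)
    (t0 : EuclideanSpace ℝ (Fin n)) (hγ0 : γ 0 = t0)
    (hlt : IsLocTrivOn f (γ '' {s : I | s ≠ 0}))
    (R ε : ℝ) (hR : 0 < R) (hε : 0 < ε)
    (hcyl : ∀ r : ℝ, R ≤ r →
      Nonempty
        (↥(f ⁻¹' {t0} \ Metric.closedBall (0 : EuclideanSpace ℝ (Fin m)) r) ≃ₜ
          ↥(f ⁻¹' {t0} ∩ Metric.sphere (0 : EuclideanSpace ℝ (Fin m)) r) × ℝ))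
    (htrans : ∀ (s : I) (u : ℝ), u ∈ Set.Icc 0 ε → ∀ x, f x = γ s → ‖x‖ = R + u →
      Function.Surjective (fderiv ℝ (fun y => (f y, ‖y‖ ^ 2)) x))
    (hltB : IsLocTrivOn
      (fun x : ↥(f ⁻¹' (Set.range γ) ∩
          Metric.closedBall (0 : EuclideanSpace ℝ (Fin m)) (R + ε)) => f x.1)
      (Set.range γ))
    (i : ℕ) (x0R : EuclideanSpace ℝ (Fin m))
    (hx0R : x0R ∈ f ⁻¹' {t0} ∩ Metric.closedBall (0 : EuclideanSpace ℝ (Fin m)) R)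
    (xsR : EuclideanSpace ℝ (Fin m))
    (hxsR : xsR ∈ connectedComponentIn
      (f ⁻¹' (Set.range γ) ∩ Metric.closedBall (0 : EuclideanSpace ℝ (Fin m)) R) x0R) :
    ∀ (hA : f ⁻¹' (Set.range γ) \
        (f ⁻¹' {t0} \ Metric.closedBall (0 : EuclideanSpace ℝ (Fin m)) R) ⊆
          f ⁻¹' (Set.range γ) \
            (f ⁻¹' {t0} \ Metric.closedBall (0 : EuclideanSpace ℝ (Fin m)) R))
      (hB : f ⁻¹' {t0} ∩ Metric.closedBall (0 : EuclideanSpace ℝ (Fin m)) R ⊆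
        f ⁻¹' (Set.range γ) ∩ Metric.closedBall (0 : EuclideanSpace ℝ (Fin m)) R),
      Function.Bijective (RelPi.incl (i := i) (x0 := x0R) hA hB) ∧
      Nonempty
        (RelPi i
            (f ⁻¹' (Set.range γ) \
              (f ⁻¹' {t0} \ Metric.closedBall (0 : EuclideanSpace ℝ (Fin m)) R))
            (f ⁻¹' {t0} ∩ Metric.closedBall (0 : EuclideanSpace ℝ (Fin m)) R) x0R ≃
          RelPi i
            (f ⁻¹' (Set.range γ) \
              (f ⁻¹' {t0} \ Metric.closedBall (0 : EuclideanSpace ℝ (Fin m)) R))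
            (f ⁻¹' (Set.range γ) ∩ Metric.closedBall (0 : EuclideanSpace ℝ (Fin m)) R)
            xsR) := by
  intro hA hB
  subst hγ0
  have hBA : f ⁻¹' range γ ∩ closedBall 0 R ⊆ f ⁻¹' range γ \ (f ⁻¹' {γ 0} \ closedBall 0 R) :=
    fun x hx => ⟨hx.1, fun h => h.2 hx.2⟩
  obtain ⟨D, hDc, hD0, hDB', hDB, hD1⟩ :=
    exists_tube_deformation hf hγc hγi hR hε htrans hltB
  have hbij : Function.Bijective (RelPi.incl (i := i) (x0 := x0R) hA hB) :=
    RelPi.incl_bijective_of_deformation hDc hD0 hDB' hDB hD1 hx0R hBA hA hB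
  refine ⟨hbij, ?_⟩
  have hxs := connectedComponentIn_subset _ _ hxsR
  have hDend : ContinuousOn (fun x => D (x, 1)) (f ⁻¹' range γ ∩ closedBall 0 R) :=
    hDc.comp (by fun_prop) fun x hx => ⟨hx, mem_univ _⟩
  have himage : D (xsR, 1) ∈ connectedComponentIn (f ⁻¹' {γ 0} ∩ closedBall 0 R) x0R := by
    have hsub := connectedComponentIn_subset (f ⁻¹' range γ ∩ closedBall 0 R) x0R
    refine IsPreconnected.subset_connectedComponentIn
      (isPreconnected_connectedComponentIn.image _ (hDend.mono hsub)) ?_ ?_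
      (mem_image_of_mem _ hxsR)
    · exact ⟨x0R, mem_connectedComponentIn (hB hx0R), hDB x0R hx0R 1⟩
    · rintro _ ⟨x, hx, rfl⟩
      exact hD1 x (hsub hx)
  have hjoin : JoinedIn (f ⁻¹' range γ ∩ closedBall 0 R) x0R (D (xsR, 1)) :=
    (joinedIn_of_mem_connectedComponentIn (hf.exists_nhds_joinedIn (γ 0) hR.le)
      hx0R himage).mono hB
  have htrack : JoinedIn (f ⁻¹' range γ ∩ closedBall 0 R) xsR (D (xsR, 1)) :=
    ⟨{ toFun := fun t => D (xsR, t)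
       continuous_toFun := continuousOn_univ.1
         (hDc.comp (by fun_prop) fun t _ => ⟨hxs, mem_univ _⟩)
       source' := hD0 xsR hxs
       target' := rfl }, fun t => hDB' xsR hxs t⟩
  obtain ⟨e⟩ := RelPi.nonempty_equiv_of_joinedIn (i := i) hBA (hjoin.trans htrack.symm)
  exact ⟨(Equiv.ofBijective _ hbij).trans e⟩
end
end

section
/- Let F = (f_1, f_2, f_3): ℝ^5 → ℝ^3 be the polynomial map defined by f_1(x,y,z,u,v) = y² + (u²x+1)(vx−1)(x² + (v−u²)x + 1), f_2(x,y,z,u,v) = (z² + u²) − v(u²+1)(z²+1), f_3(x,y,z,u,v) = u, and let δ = {(0,0,s) ∈ ℝ^3 : s ∈ [0,1]}. Then the relative homotopy group π_2(F^{-1}(δ), F^{-1}(0,0,0)) is non-trivial: there exist a point x_0 ∈ F^{-1}(0,0,0) and a continuous map h: I² → F^{-1}(δ) with h(I¹ × {0}) ⊆ F^{-1}(0,0,0) and h(J_2) = {x_0} such that h is not homotopic, through maps of the same form, to any map with image contained in F^{-1}(0,0,0). -/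
open scoped unitInterval
open Set Filter Topology Metric

noncomputable section

/-- The polynomial map `F = (f₁, f₂, f₃) : ℝ⁵ → ℝ³` from Section 5. -/
def Fmap : ℝ × ℝ × ℝ × ℝ × ℝ → ℝ × ℝ × ℝ :=
  fun (x, y, z, u, v) =>
    (y ^ 2 + (u ^ 2 * x + 1) * (v * x - 1) * (x ^ 2 + (v - u ^ 2) * x + 1),
      (z ^ 2 + u ^ 2) - v * (u ^ 2 + 1) * (z ^ 2 + 1),
      u)

/-- The arc `δ = {(0,0,s) : s ∈ [0,1]} ⊆ ℝ³`. -/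
def arcδ : Set (ℝ × ℝ × ℝ) := {w | w.1 = 0 ∧ w.2.1 = 0 ∧ w.2.2 ∈ Set.Icc (0 : ℝ) 1}

/-! ### Continuous logarithms of loops in the punctured plane -/

/-- A closed loop `γ : [0,1] → ℂ` avoiding `0` with a continuous logarithm that is itself
closed, i.e. a loop of winding number zero around the origin. -/
def HasClosedLog (γ : I → ℂ) : Prop :=
  ∃ L : I → ℂ, Continuous L ∧ (∀ t, Complex.exp (L t) = γ t) ∧ L 0 = L 1

theorem eq_of_exp_eq_one {X : Type*} [TopologicalSpace X] [PreconnectedSpace X] {f : X → ℂ}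
    (hf : Continuous f) (h : ∀ x, Complex.exp (f x) = 1) (x y : X) : f x = f y := by
  have := Complex.isCoveringMap_exp.eq_of_comp_eq hf (continuous_const (y := f y))
    (funext fun z => Subtype.ext (by simp [h])) y rfl
  exact congrFun this x

theorem exists_continuous_log {K : I × I → ℂ} (hK : Continuous K) (h0 : ∀ p, K p ≠ 0) :
    ∃ L : I × I → ℂ, Continuous L ∧ ∀ p, Complex.exp (L p) = K p := by
  let pr : ℝ × ℝ → I × I := fun p =>
    (projIcc 0 1 zero_le_one p.1, projIcc 0 1 zero_le_one p.2)
  have hpr : Continuous pr :=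
    (continuous_projIcc.comp continuous_fst).prodMk (continuous_projIcc.comp continuous_snd)
  obtain ⟨L, ⟨-, hL⟩, -⟩ := Complex.isCoveringMapOn_exp.existsUnique_continuousMap_lifts
    ⟨K ∘ pr, hK.comp hpr⟩ (a₀ := (0, 0)) (Complex.exp_log (h0 (pr (0, 0)))) fun p => h0 (pr p)
  refine ⟨fun p => L (p.1, p.2), by fun_prop, fun p => ?_⟩
  have := congrFun hL ((p.1 : ℝ), (p.2 : ℝ))
  simpa [pr] using this

theorem HasClosedLog.of_homotopy {K : I × I → ℂ} (hK : Continuous K) (h0 : ∀ p, K p ≠ 0)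
    (hcl : ∀ τ, K (0, τ) = K (1, τ)) (h : HasClosedLog fun t => K (t, 1)) :
    HasClosedLog fun t => K (t, 0) := by
  obtain ⟨M, hM, hMK⟩ := exists_continuous_log hK h0
  obtain ⟨l, hl, hlK, hl01⟩ := h
  have hend : M (0, 1) - l 0 = M (1, 1) - l 1 :=
    eq_of_exp_eq_one (f := fun t => M (t, 1) - l t) (by fun_prop)
      (fun t => by rw [Complex.exp_sub, hMK, hlK, div_self (h0 _)]) 0 1
  have hside : M (0, 0) - M (1, 0) = M (0, 1) - M (1, 1) :=
    eq_of_exp_eq_one (f := fun τ => M (0, τ) - M (1, τ)) (by fun_prop)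
      (fun τ => by rw [Complex.exp_sub, hMK, hMK, hcl, div_self (h0 _)]) 0 1
  refine ⟨fun t => M (t, 0), by fun_prop, fun t => hMK _, ?_⟩
  linear_combination hside + hend + hl01

theorem hasClosedLog_const {a : ℂ} (ha : a ≠ 0) : HasClosedLog fun _ => a :=
  ⟨fun _ => Complex.log a, continuous_const, fun _ => Complex.exp_log ha, rfl⟩

theorem not_hasClosedLog_of_mem_slitPlane {γ : I → ℂ} (hγ : γ 0 = γ 1)
    (h : ∀ t : I, γ t * Complex.exp (-(2 * Real.pi * Complex.I * (t : ℝ))) ∈ Complex.slitPlane) :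
    ¬ HasClosedLog γ := by
  rintro ⟨L, hL, hLγ, h01⟩
  have hγc : Continuous γ := by
    rw [← funext hLγ]
    fun_prop
  have key := eq_of_exp_eq_one
    (f := fun t : I => L t + -(2 * Real.pi * Complex.I * (t : ℝ)) -
      Complex.log (γ t * Complex.exp (-(2 * Real.pi * Complex.I * (t : ℝ)))))
    (Continuous.sub (by fun_prop) (Continuous.clog (by fun_prop) h))
    (fun t => by
      rw [Complex.exp_sub, Complex.exp_log (Complex.slitPlane_ne_zero (h t)), Complex.exp_add,
        hLγ, div_self (Complex.slitPlane_ne_zero (h t))]) 0 1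
  have hper : Complex.exp (-(2 * Real.pi * Complex.I)) = 1 := by
    rw [Complex.exp_neg, Complex.exp_two_pi_mul_I, inv_one]
  simp [h01, hγ, hper] at key

/-! ### A disk in `F⁻¹(δ)` -/

/-- A map from `ℝ³` to `ℝ⁵` which sends the points `(c, z, s)` of the half-sphere `s ≥ 0` of the
unit sphere into `F⁻¹(δ)`, over the value `(0, 0, s)`. -/
def diskMap (w : ℝ × ℝ × ℝ) : ℝ × ℝ × ℝ × ℝ × ℝ :=
  let c := w.1
  let z := w.2.1
  let s := w.2.2
  let x := (s ^ 2 + 1) * (z ^ 2 + 1)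
  let v := (z ^ 2 + s ^ 2) / ((s ^ 2 + 1) * (z ^ 2 + 1))
  (x, c * √((s ^ 2 * x + 1) * (x ^ 2 + (v - s ^ 2) * x + 1)), z, s, v)

theorem continuous_diskMap : Continuous diskMap := by
  unfold diskMap
  fun_prop (disch := intro; positivity)

theorem Fmap_diskMap {c z s : ℝ} (h : c ^ 2 + z ^ 2 + s ^ 2 = 1) :
    Fmap (diskMap (c, z, s)) = (0, 0, s) := by
  have hx : 0 < (s ^ 2 + 1) * (z ^ 2 + 1) := by positivity
  have hvx : (z ^ 2 + s ^ 2) / ((s ^ 2 + 1) * (z ^ 2 + 1)) * ((s ^ 2 + 1) * (z ^ 2 + 1)) =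
      z ^ 2 + s ^ 2 := div_mul_cancel₀ _ hx.ne'
  simp only [diskMap, Fmap]
  generalize (z ^ 2 + s ^ 2) / ((s ^ 2 + 1) * (z ^ 2 + 1)) = v at *
  have hnn : 0 ≤ (s ^ 2 * ((s ^ 2 + 1) * (z ^ 2 + 1)) + 1) *
      (((s ^ 2 + 1) * (z ^ 2 + 1)) ^ 2 + (v - s ^ 2) * ((s ^ 2 + 1) * (z ^ 2 + 1)) + 1) := by
    generalize (s ^ 2 + 1) * (z ^ 2 + 1) = x at *
    have hs : s ^ 2 ≤ 1 := by nlinarith [sq_nonneg c, sq_nonneg z]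
    refine mul_nonneg (by positivity) ?_
    nlinarith [sq_nonneg (x - 1), sq_nonneg z, sq_nonneg s, mul_nonneg hx.le (sub_nonneg.2 hs)]
  refine Prod.ext ?_ (Prod.ext ?_ rfl)
  · simp only
    rw [mul_pow, Real.sq_sqrt hnn, hvx]
    linear_combination ((s ^ 2 * ((s ^ 2 + 1) * (z ^ 2 + 1)) + 1) *
      (((s ^ 2 + 1) * (z ^ 2 + 1)) ^ 2 + (v - s ^ 2) * ((s ^ 2 + 1) * (z ^ 2 + 1)) + 1)) * h
  · simp only
    linear_combination -hvx

/-- The unit disk contracted along segments onto its boundary point `(1, 0)`, and lifted to the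
half-sphere `s ≥ 0`. -/
def coneMap (t r : ℝ) : ℝ × ℝ × ℝ :=
  ((1 - r) * Real.cos (2 * Real.pi * t) + r, (1 - r) * Real.sin (2 * Real.pi * t),
    √(2 * r * (1 - r) * (1 - Real.cos (2 * Real.pi * t))))

theorem Fmap_diskMap_coneMap {t r : ℝ} (hr0 : 0 ≤ r) (hr1 : r ≤ 1) :
    Fmap (diskMap (coneMap t r)) = (0, 0, (coneMap t r).2.2) := by
  have hcos := sub_nonneg.2 (Real.cos_le_one (2 * Real.pi * t))
  have hr := sub_nonneg.2 hr1
  refine Fmap_diskMap ?_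
  rw [Real.sq_sqrt (mul_nonneg (mul_nonneg (mul_nonneg zero_le_two hr0) hr) hcos)]
  linear_combination (1 - r) ^ 2 * Real.sin_sq_add_cos_sq (2 * Real.pi * t)

theorem coneMap_mem_Icc {t r : ℝ} (hr0 : 0 ≤ r) (hr1 : r ≤ 1) :
    (coneMap t r).2.2 ∈ Icc (0 : ℝ) 1 := by
  have hr := mul_nonneg hr0 (sub_nonneg.2 hr1)
  refine ⟨Real.sqrt_nonneg _, Real.sqrt_le_one.2 ?_⟩
  nlinarith [sq_nonneg (2 * r - 1), Real.neg_one_le_cos (2 * Real.pi * t)]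

/-- The projection of `F⁻¹(0,0,0)` to the `(y,z)`-plane avoids the origin. -/
theorem yz_ne_zero_of_mem_fiber {w : ℝ × ℝ × ℝ × ℝ × ℝ}
    (hw : w ∈ Fmap ⁻¹' {((0 : ℝ), (0 : ℝ), (0 : ℝ))}) :
    (⟨w.2.1, w.2.2.1⟩ : ℂ) ≠ 0 := by
  obtain ⟨x, y, z, u, v⟩ := w
  intro h
  obtain ⟨hy, hz⟩ := Complex.ext_iff.1 h
  simp only [Complex.zero_re, Complex.zero_im] at hy hz
  simp only [Fmap, mem_preimage, mem_singleton_iff, Prod.mk.injEq, hy, hz] at hw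
  obtain ⟨h1, h2, rfl⟩ := hw
  have hv : v = 0 := by linear_combination -h2
  subst hv
  nlinarith [sq_nonneg x]

theorem isRelMap_cone : IsRelMap 1 (Fmap ⁻¹' arcδ) (Fmap ⁻¹' {((0 : ℝ), (0 : ℝ), (0 : ℝ))})
    (diskMap (1, 0, 0)) fun p => diskMap (coneMap (p 0) (p 1)) where
  continuous := by
    refine continuous_diskMap.comp ?_
    unfold coneMap
    fun_prop
  mem_total p := by
    simp only [mem_preimage, Fmap_diskMap_coneMap (p 1).2.1 (p 1).2.2]
    exact ⟨rfl, rfl, coneMap_mem_Icc (p 1).2.1 (p 1).2.2⟩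
  mem_base p hp := by
    have hp : p 1 = 0 := hp
    simp only [mem_preimage, Fmap_diskMap_coneMap (p 1).2.1 (p 1).2.2]
    simp [hp, coneMap]
  eq_base_pt p hp := by
    have h : p 0 = 0 ∨ p 0 = 1 ∨ p 1 = 1 := by
      obtain ⟨⟨j, hj⟩, hp⟩ := hp
      by_contra! hne
      have hj1 : p 1 = 0 := by
        fin_cases j
        · exact absurd hj (by simp [hne.1, hne.2.1])
        · exact hj.resolve_right hne.2.2
      refine hp ⟨hj1, fun j => ?_⟩
      rw [Subsingleton.elim j 0]
      exact ⟨hne.1, hne.2.1⟩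
    rcases h with h | h | h <;> simp [h, coneMap]

/-- The projection to the `(y,z)`-plane of the boundary of the disk winds around the origin. -/
theorem not_hasClosedLog_boundary :
    ¬ HasClosedLog fun t =>
      (⟨(diskMap (coneMap t 0)).2.1, (diskMap (coneMap t 0)).2.2.1⟩ : ℂ) := by
  refine not_hasClosedLog_of_mem_slitPlane (by simp [coneMap]) fun t => Or.inl ?_
  have hexp : Complex.exp (-(2 * Real.pi * Complex.I * (t : ℝ))) =
      ⟨Real.cos (2 * Real.pi * t), -Real.sin (2 * Real.pi * t)⟩ := by
    rw [show -(2 * Real.pi * Complex.I * (t : ℝ)) =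
      ((-(2 * Real.pi * (t : ℝ)) : ℝ) : ℂ) * Complex.I by push_cast; ring]
    refine Complex.ext ?_ ?_
    · rw [Complex.exp_ofReal_mul_I_re, Real.cos_neg]
    · rw [Complex.exp_ofReal_mul_I_im, Real.sin_neg]
  rw [hexp, Complex.mul_re]
  simp only [coneMap, diskMap, sub_zero, one_mul, add_zero, mul_zero, zero_mul, Real.sqrt_zero]
  generalize hz : Real.sin (2 * Real.pi * t) = z
  generalize hc : Real.cos (2 * Real.pi * t) = c
  have hcz : z ^ 2 + c ^ 2 = 1 := by rw [← hz, ← hc]; exact Real.sin_sq_add_cos_sq _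
  generalize hq : √(_ : ℝ) = q
  have hq0 : 0 < q := by
    rw [← hq, Real.sqrt_pos]
    have hv : 0 ≤ (z ^ 2 + 0 ^ 2) / ((0 ^ 2 + 1) * (z ^ 2 + 1)) - 0 ^ 2 := by
      rw [zero_pow two_ne_zero, sub_zero]; positivity
    positivity
  rcases eq_or_ne c 0 with rfl | hc0
  · nlinarith
  · nlinarith [mul_pos hq0 (pow_pos (abs_pos.2 hc0) 2), sq_abs c, sq_nonneg z]

/-- **Claim 4 of Section 5.** The relative homotopy group
`π₂(F⁻¹(δ), F⁻¹(0,0,0))` is non-trivial: there are a base point `x₀ ∈ F⁻¹(0,0,0)` and a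
continuous map `h : I² → F⁻¹(δ)` with `h(I¹ × {0}) ⊆ F⁻¹(0,0,0)` and `h(J₂) = {x₀}` that
is not homotopic, through maps of the same form, to any map into `F⁻¹(0,0,0)`. -/
theorem pi2_F_nontrivial :
    ∃ x0 ∈ Fmap ⁻¹' {((0 : ℝ), (0 : ℝ), (0 : ℝ))},
      ¬ RelPiTrivial 1 (Fmap ⁻¹' arcδ) (Fmap ⁻¹' {((0 : ℝ), (0 : ℝ), (0 : ℝ))}) x0 := by
  refine ⟨diskMap (1, 0, 0), by simp [Fmap_diskMap], fun htriv => ?_⟩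
  obtain ⟨h', hrel', hB', H, hH, hHrel, hH0, hH1⟩ := htriv _ isRelMap_cone
  have hleft (r : I) : ![0, r] ∈ JSet 1 :=
    ⟨⟨0, Or.inl rfl⟩, fun hp => (hp.2 0).1 rfl⟩
  have hright (r : I) : ![1, r] ∈ JSet 1 :=
    ⟨⟨0, Or.inr rfl⟩, fun hp => (hp.2 0).2 rfl⟩
  have htop (t : I) : ![t, 1] ∈ JSet 1 :=
    ⟨⟨1, Or.inr rfl⟩, fun hp => one_ne_zero hp.1⟩
  let π : ℝ × ℝ × ℝ × ℝ × ℝ → ℂ := fun w => ⟨w.2.1, w.2.2.1⟩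
  have hπ : Continuous π := by
    simp only [π, Complex.mk_eq_add_mul_I]
    fun_prop
  have hedge : Continuous fun q : I × I => h' ![q.1, q.2] :=
    hrel'.continuous.comp (by fun_prop)
  have hbottom : Continuous fun q : I × I => H (![q.1, 0], q.2) :=
    hH.comp (by fun_prop)
  have hclosed' : HasClosedLog fun t => π (h' ![t, 0]) := by
    refine HasClosedLog.of_homotopy (K := fun q => π (h' ![q.1, q.2])) (hπ.comp hedge)
      (fun q => yz_ne_zero_of_mem_fiber (hB' _)) (fun r => ?_) ?_
    · simp only [hrel'.eq_base_pt _ (hleft r), hrel'.eq_base_pt _ (hright r)]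
    · simp only [hrel'.eq_base_pt _ (htop _)]
      exact hasClosedLog_const (yz_ne_zero_of_mem_fiber (by simp [Fmap_diskMap]))
  have hclosed : HasClosedLog fun t => π (H (![t, 0], 0)) := by
    refine HasClosedLog.of_homotopy (K := fun q => π (H (![q.1, 0], q.2))) (hπ.comp hbottom)
      (fun q => yz_ne_zero_of_mem_fiber ((hHrel q.2).mem_base _ rfl)) (fun τ => ?_) ?_
    · have h0 := (hHrel τ).eq_base_pt _ (hleft 0)
      have h1 := (hHrel τ).eq_base_pt _ (hright 0)
      simp only [h0, h1]
    · simpa only [hH1] using hclosed'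
  refine not_hasClosedLog_boundary ?_
  simpa [hH0] using hclosed
end
end
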